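/- Let n ≥ 2 and let μ = f·ν be a finite complex Borel measure on S^{2n−1}. Suppose there exist ε ∈ (0,1) and a finite set F ⊆ ℤ₊² such that for every (p,q) ∈ ℤ₊² ∖ F with (p,q) ∈ κ(ε) one has π_{p,q}μ = 0 (i.e. spec(μ) ∩ κ(ε) is finite or empty). Then for every set E ⊆ S^{2n−1} with H^{2n−2}(E) = 0 one has |μ|(𝕋·E) = ∫_{𝕋·E} |f| dν = 0. -/

import Mathlib

open MeasureTheory Metric Set
open scoped ENNReal NNReal

noncomputable section

instance {n : ℕ} : MeasurableSpace (EuclideanSpace ℂ (Fin n)) := borel _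
instance {n : ℕ} : BorelSpace (EuclideanSpace ℂ (Fin n)) := ⟨rfl⟩

/-- The unit sphere `S^{2n−1} ⊆ ℂⁿ`. -/
def unitSphere (n : ℕ) : Set (EuclideanSpace ℂ (Fin n)) :=
  Metric.sphere 0 1

/-- The real Laplacian (in the `2n` real variables) of `P : ℂⁿ → ℂ` at `z`, computed
with respect to the orthonormal real basis `e_j, i·e_j`. -/
def cplxLaplacian {n : ℕ} (P : EuclideanSpace ℂ (Fin n) → ℂ)
    (z : EuclideanSpace ℂ (Fin n)) : ℂ :=
  ∑ j : Fin n,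
    (fderiv ℝ (fun w => fderiv ℝ P w (EuclideanSpace.single j 1)) z
        (EuclideanSpace.single j 1) +
      fderiv ℝ (fun w => fderiv ℝ P w (Complex.I • EuclideanSpace.single j 1)) z
        (Complex.I • EuclideanSpace.single j 1))

/-- `P : ℂⁿ → ℂ` is (the extension of) an element of `H(p,q)`: smooth, harmonic in the
`2n` real variables, and `(p,q)`-homogeneous: `P(λz) = λᵖ (conj λ)^q P(z)`. -/
def MemHpq (n p q : ℕ) (P : EuclideanSpace ℂ (Fin n) → ℂ) : Prop :=
  ContDiff ℝ (⊤ : ℕ∞) P ∧ (∀ z, cplxLaplacian P z = 0) ∧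
  ∀ (c : ℂ) (z : EuclideanSpace ℂ (Fin n)),
    P (c • z) = c ^ p * (starRingEnd ℂ c) ^ q * P z

/-- `π_{p,q}μ = 0` for the complex measure `μ = f·ν` on the sphere:
`∫ conj(h) dμ = 0` for every `h ∈ H(p,q)`. -/
def projPQZero {n : ℕ} (ν : Measure (EuclideanSpace ℂ (Fin n)))
    (f : EuclideanSpace ℂ (Fin n) → ℂ) (p q : ℕ) : Prop :=
  ∀ P : EuclideanSpace ℂ (Fin n) → ℂ, MemHpq n p q P →
    ∫ z, (starRingEnd ℂ) (P z) * f z ∂ν = 0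

/-- `(p,q) ∈ κ(ε) = {(x,y) ∈ (0,∞)² : 1−ε < y/x < 1/(1−ε)}`. -/
def memKappa (ε : ℝ) (p q : ℕ) : Prop :=
  0 < p ∧ 0 < q ∧ 1 - ε < (q : ℝ) / p ∧ (q : ℝ) / p < 1 / (1 - ε)

/-- The circle orbit `𝕋·E = {e^{it} z : z ∈ E, t ∈ ℝ}`. -/
def circleOrbit {n : ℕ} (E : Set (EuclideanSpace ℂ (Fin n))) :
    Set (EuclideanSpace ℂ (Fin n)) :=
  {w | ∃ z ∈ E, ∃ t : ℝ, w = Complex.exp (t * Complex.I) • z}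

section Helpers

open MvPolynomial



abbrev Pol (n : ℕ) := MvPolynomial (Fin n ⊕ Fin n) ℂ

/-- bidegree weights -/
def bw (n : ℕ) : Fin n ⊕ Fin n → ℕ × ℕ := Sum.elim (fun _ => (1, 0)) (fun _ => (0, 1))

/-- bihomogeneous of bidegree `(p,q)` -/
def BH {n : ℕ} (P : Pol n) (p q : ℕ) : Prop := IsWeightedHomogeneous (bw n) P (p, q)

def Lap {n : ℕ} (P : Pol n) : Pol n := ∑ j : Fin n, pderiv (Sum.inl j) (pderiv (Sum.inr j) P)

def rr (n : ℕ) : Pol n := ∑ j : Fin n, X (Sum.inl j) * X (Sum.inr j)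

lemma BH.isHomogeneous {n p q : ℕ} {P : Pol n} (h : BH P p q) : P.IsHomogeneous (p + q) := by
  intro d hd
  have h1 := h hd
  have h2 : Finsupp.weight (1 : Fin n ⊕ Fin n → ℕ) d
      = (Finsupp.weight (bw n) d).1 + (Finsupp.weight (bw n) d).2 := by
    simp [Finsupp.weight_apply, Finsupp.sum_fintype, bw, Prod.fst_sum, Prod.snd_sum]
  rw [h2, h1]

lemma BH.mul {n p q p' q' : ℕ} {P Q : Pol n} (h : BH P p q) (h' : BH Q p' q') :
    BH (P * Q) (p + p') (q + q') := IsWeightedHomogeneous.mul h h'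

lemma BH.add {n p q : ℕ} {P Q : Pol n} (h : BH P p q) (h' : BH Q p q) :
    BH (P + Q) p q := IsWeightedHomogeneous.add h h'

lemma BH.sub {n p q : ℕ} {P Q : Pol n} (h : BH P p q) (h' : BH Q p q) :
    BH (P - Q) p q := IsWeightedHomogeneous.sub h h'

lemma BH.C_mul {n p q : ℕ} {P : Pol n} (h : BH P p q) (c : ℂ) :
    BH (C c * P) p q := IsWeightedHomogeneous.C_mul h c

lemma BH_zero {n p q : ℕ} : BH (0 : Pol n) p q := isWeightedHomogeneous_zero _ _ _

lemma BH_rr (n : ℕ) : BH (rr n) 1 1 := by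
  apply IsWeightedHomogeneous.sum
  intro j _
  have := (isWeightedHomogeneous_X ℂ (bw n) (Sum.inl j)).mul (isWeightedHomogeneous_X ℂ (bw n) (Sum.inr j))
  simpa [bw] using this

lemma BH.pderiv_inl {n p q : ℕ} {P : Pol n} (h : BH P (p + 1) q) (j : Fin n) :
    BH (pderiv (Sum.inl j) P) p q := by
  apply IsWeightedHomogeneous.pderiv h
  simp [bw]

lemma BH.pderiv_inr {n p q : ℕ} {P : Pol n} (h : BH P p (q + 1)) (j : Fin n) :
    BH (pderiv (Sum.inr j) P) p q := by
  apply IsWeightedHomogeneous.pderiv h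
  simp [bw]

lemma BH.Lap {n p q : ℕ} {P : Pol n} (h : BH P (p + 1) (q + 1)) : BH (Lap P) p q := by
  apply IsWeightedHomogeneous.sum
  intro j _
  exact (h.pderiv_inr j).pderiv_inl j

lemma pderiv_eq_zero_of {n : ℕ} {P : Pol n} (i : Fin n ⊕ Fin n)
    (h : ∀ d ∈ P.support, d i = 0) : pderiv i P = 0 := by
  apply pderiv_eq_zero_of_notMem_vars
  rw [mem_vars_iff_mem_support]
  rintro ⟨d, hd, hi⟩
  exact (Finsupp.mem_support_iff.1 hi) (h d hd)

lemma pderiv_comm_pol {n : ℕ} (P : Pol n) (i k : Fin n ⊕ Fin n) :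
    pderiv i (pderiv k P) = pderiv k (pderiv i P) := by
  have h : ⁅pderiv (R := ℂ) i, pderiv (R := ℂ) k⁆ = 0 := by
    apply derivation_ext
    intro m
    rw [Derivation.commutator_apply]
    simp only [pderiv_X, Pi.single_apply]
    split_ifs <;> simp
  have h2 := congrArg (fun D => D P) h
  simp only [Derivation.commutator_apply, Derivation.zero_apply] at h2
  exact sub_eq_zero.1 h2

lemma Lap_zero_left {n q : ℕ} {P : Pol n} (h : BH P 0 q) : Lap P = 0 := by
  unfold Lap
  apply Finset.sum_eq_zero
  intro j _
  rw [pderiv_comm_pol]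
  rw [pderiv_eq_zero_of (Sum.inl j), map_zero]
  intro d hd
  have h1 := h (mem_support_iff.1 hd)
  have h2 := congrArg Prod.fst h1
  simp [Finsupp.weight_apply, Finsupp.sum_fintype, bw, Prod.fst_sum] at h2
  exact h2 j

lemma Lap_zero_right {n p : ℕ} {P : Pol n} (h : BH P p 0) : Lap P = 0 := by
  unfold Lap
  apply Finset.sum_eq_zero
  intro j _
  rw [pderiv_eq_zero_of (Sum.inr j), map_zero]
  intro d hd
  have h1 := h (mem_support_iff.1 hd)
  have h2 := congrArg Prod.snd h1
  simp [Finsupp.weight_apply, Finsupp.sum_fintype, bw, Prod.snd_sum] at h2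
  exact h2 j

lemma pderiv_inr_rr {n : ℕ} (j : Fin n) : pderiv (Sum.inr j) (rr n) = X (Sum.inl j) := by
  simp [rr, Derivation.leibniz, pderiv_X, Pi.single_apply]

lemma pderiv_inl_rr {n : ℕ} (j : Fin n) : pderiv (Sum.inl j) (rr n) = X (Sum.inr j) := by
  simp [rr, Derivation.leibniz, pderiv_X, Pi.single_apply]

lemma Lap_add {n : ℕ} (P Q : Pol n) : Lap (P + Q) = Lap P + Lap Q := by
  simp [Lap, Finset.sum_add_distrib]
lemma Lap_sub {n : ℕ} (P Q : Pol n) : Lap (P - Q) = Lap P - Lap Q := by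
  simp [Lap, Finset.sum_sub_distrib]
lemma Lap_C_mul {n : ℕ} (c : ℂ) (P : Pol n) : Lap (C c * P) = C c * Lap P := by
  simp [Lap, Finset.mul_sum]

lemma Lap_rr_mul {n p q : ℕ} {P : Pol n} (h : BH P p q) :
    Lap (rr n * P) = rr n * Lap P + ((n + p + q : ℕ) : Pol n) * P := by
  have he := h.isHomogeneous.sum_X_mul_pderiv
  rw [Fintype.sum_sum_type] at he
  have : ∀ j : Fin n, pderiv (Sum.inl j) (pderiv (Sum.inr j) (rr n * P)) =
      P + X (Sum.inl j) * pderiv (Sum.inl j) P + X (Sum.inr j) * pderiv (Sum.inr j) P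
      + rr n * pderiv (Sum.inl j) (pderiv (Sum.inr j) P) := by
    intro j
    simp only [Derivation.leibniz, pderiv_inr_rr, pderiv_inl_rr, map_add, pderiv_X, smul_eq_mul,
      Pi.single_apply]
    simp
    ring
  unfold Lap
  rw [Finset.sum_congr rfl fun j _ => this j]
  simp only [Finset.sum_add_distrib, ← Finset.mul_sum]
  simp only [nsmul_eq_mul, Finset.sum_const, Finset.card_univ, Fintype.card_fin] at he ⊢
  push_cast at he ⊢
  linear_combination he

lemma BH_rr_pow_mul {n p q : ℕ} {P : Pol n} (h : BH P p q) (j : ℕ) :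
    BH (rr n ^ j * P) (p + j) (q + j) := by
  induction j with
  | zero => simpa using h
  | succ j ih =>
    have := (BH_rr n).mul ih
    rw [pow_succ', mul_assoc]
    convert this using 1 <;> ring

lemma Lap_rr_pow_mul {n p q : ℕ} {P : Pol n} (h : BH P p q) (j : ℕ) :
    Lap (rr n ^ (j + 1) * P) = rr n ^ (j + 1) * Lap P
      + (((j + 1) * (n + p + q + j) : ℕ) : Pol n) * (rr n ^ j * P) := by
  induction j with
  | zero => simpa using Lap_rr_mul h
  | succ j ih =>
    rw [pow_succ', mul_assoc, Lap_rr_mul (BH_rr_pow_mul h (j + 1)), ih]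
    push_cast
    ring

lemma exists_Lap_aux {n : ℕ} (hn : 0 < n) : ∀ (m : ℕ) (p q : ℕ) (P : Pol n), p ≤ m → BH P p q →
    ∀ j, ∃ Q : Pol n, BH Q (p + j) (q + j) ∧ Lap (rr n * Q) = rr n ^ j * P := by
  intro m
  induction m with
  | zero =>
    intro p q P hp h j
    obtain rfl : p = 0 := by omega
    have h0 := Lap_zero_left h
    have hc : (((j + 1) * (n + 0 + q + j) : ℕ) : ℂ) ≠ 0 := by
      exact_mod_cast (by positivity)
    refine ⟨C ((((j + 1) * (n + 0 + q + j) : ℕ) : ℂ)⁻¹) * (rr n ^ j * P),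
      (BH_rr_pow_mul h j).C_mul _, ?_⟩
    have := Lap_rr_pow_mul h j
    rw [h0, mul_zero, zero_add, pow_succ', mul_assoc] at this
    rw [mul_left_comm, Lap_C_mul, this, ← mul_assoc, ← map_natCast (C : ℂ →+* Pol n), ← C_mul, inv_mul_cancel₀ hc]
    simp
  | succ m ih =>
    intro p q P hp h j
    have hc : (((j + 1) * (n + p + q + j) : ℕ) : ℂ) ≠ 0 := by
      exact_mod_cast (by positivity)
    have key : ∃ R : Pol n, BH R (p + j) (q + j) ∧ Lap (rr n * R) = rr n ^ (j + 1) * Lap P := by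
      rcases Nat.eq_zero_or_pos p with rfl | hp0
      · exact ⟨0, BH_zero, by rw [Lap_zero_left h]; simp [Lap]⟩
      rcases Nat.eq_zero_or_pos q with rfl | hq0
      · exact ⟨0, BH_zero, by rw [Lap_zero_right h]; simp [Lap]⟩
      obtain ⟨p, rfl⟩ : ∃ p', p = p' + 1 := ⟨p - 1, by omega⟩
      obtain ⟨q, rfl⟩ : ∃ q', q = q' + 1 := ⟨q - 1, by omega⟩
      obtain ⟨R, hR, hR'⟩ := ih p q (Lap P) (by omega) h.Lap (j + 1)
      refine ⟨R, ?_, hR'⟩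
      convert hR using 1 <;> ring
    obtain ⟨R, hR, hR'⟩ := key
    refine ⟨C ((((j + 1) * (n + p + q + j) : ℕ) : ℂ)⁻¹) * (rr n ^ j * P - R),
      ((BH_rr_pow_mul h j).sub hR).C_mul _, ?_⟩
    have := Lap_rr_pow_mul h j
    rw [pow_succ', mul_assoc] at this
    rw [mul_left_comm, Lap_C_mul, mul_sub, Lap_sub, hR', this, pow_succ', mul_assoc, add_sub_cancel_left, ← mul_assoc,
      ← map_natCast (C : ℂ →+* Pol n), ← C_mul, inv_mul_cancel₀ hc]
    simp

/-- Fischer decomposition step. -/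
lemma fischer {n p q : ℕ} (hn : 0 < n) {P : Pol n} (h : BH P (p + 1) (q + 1)) :
    ∃ Q : Pol n, BH Q p q ∧ Lap (P - rr n * Q) = 0 ∧ BH (P - rr n * Q) (p + 1) (q + 1) := by
  obtain ⟨Q, hQ, hQ'⟩ := exists_Lap_aux hn p p q (Lap P) le_rfl h.Lap 0
  refine ⟨Q, hQ, ?_, h.sub ?_⟩
  · rw [Lap_sub, hQ']; simp
  · have := (BH_rr n).mul hQ
    rwa [add_comm 1, add_comm 1] at this

/-! conjugate polynomial -/
def cj {n : ℕ} (P : Pol n) : Pol n := rename Sum.swap (map (starRingEnd ℂ) P)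

lemma cj_BH {n p q : ℕ} {P : Pol n} (h : BH P p q) : BH (cj P) q p := by
  intro d hd
  unfold cj at hd
  obtain ⟨u, rfl, hu⟩ := coeff_rename_ne_zero _ _ _ hd
  rw [coeff_map] at hu
  have h1 := h (d := u) (fun h0 => hu (by simp [h0]))
  have : ∀ u : Fin n ⊕ Fin n →₀ ℕ, Finsupp.weight (bw n) (u.mapDomain Sum.swap) = (Finsupp.weight (bw n) u).swap := by
    intro u
    induction u using Finsupp.induction_linear with
    | zero => simp
    | add f g hf hg => rw [Finsupp.mapDomain_add, map_add, hf, hg, map_add]; rfl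
    | single i c => 
      rw [Finsupp.mapDomain_single]
      rcases i with i | i <;> simp [Finsupp.weight_apply, bw, Prod.ext_iff]
  rw [this, h1]; rfl

lemma cj_pderiv_inl {n : ℕ} (P : Pol n) (j : Fin n) : cj (pderiv (Sum.inl j) P) = pderiv (Sum.inr j) (cj P) := by
  unfold cj
  have : (Sum.inr j : Fin n ⊕ Fin n) = Sum.swap (Sum.inl j) := rfl
  rw [this, pderiv_rename Sum.swap_leftInverse.injective, pderiv_map]
lemma cj_pderiv_inr {n : ℕ} (P : Pol n) (j : Fin n) : cj (pderiv (Sum.inr j) P) = pderiv (Sum.inl j) (cj P) := by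
  unfold cj
  have : (Sum.inl j : Fin n ⊕ Fin n) = Sum.swap (Sum.inr j) := rfl
  rw [this, pderiv_rename Sum.swap_leftInverse.injective, pderiv_map]

lemma cj_Lap {n : ℕ} {P : Pol n} (h : Lap P = 0) : Lap (cj P) = 0 := by
  have : Lap (cj P) = cj (Lap P) := by
    unfold Lap
    have : ∀ f : Fin n → Pol n, cj (∑ j, f j) = ∑ j, cj (f j) := by
      intro f; simp [cj]
    rw [this]
    refine Finset.sum_congr rfl fun j _ => ?_
    rw [cj_pderiv_inl, cj_pderiv_inr, pderiv_comm_pol]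
  rw [this, h]; simp [cj]



abbrev Ez (n : ℕ) := EuclideanSpace ℂ (Fin n)

def cv {n : ℕ} (z : Ez n) : Fin n ⊕ Fin n → ℂ :=
  Sum.elim (fun j => z j) (fun j => starRingEnd ℂ (z j))

def ev {n : ℕ} (P : Pol n) (z : Ez n) : ℂ := eval (cv z) P

@[simp] lemma ev_add {n : ℕ} (P Q : Pol n) (z : Ez n) : ev (P + Q) z = ev P z + ev Q z := by simp [ev]
@[simp] lemma ev_sub {n : ℕ} (P Q : Pol n) (z : Ez n) : ev (P - Q) z = ev P z - ev Q z := by simp [ev]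
@[simp] lemma ev_mul {n : ℕ} (P Q : Pol n) (z : Ez n) : ev (P * Q) z = ev P z * ev Q z := by simp [ev]
@[simp] lemma ev_C {n : ℕ} (c : ℂ) (z : Ez n) : ev (C c) z = c := by simp [ev]
@[simp] lemma ev_zero {n : ℕ} (z : Ez n) : ev 0 z = 0 := by simp [ev]
@[simp] lemma ev_sum {n : ℕ} {ι : Type*} (s : Finset ι) (P : ι → Pol n) (z : Ez n) :
    ev (∑ i ∈ s, P i) z = ∑ i ∈ s, ev (P i) z := by simp [ev]
@[simp] lemma ev_X_inl {n : ℕ} (j : Fin n) (z : Ez n) : ev (X (Sum.inl j)) z = z j := by simp [ev, cv]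
@[simp] lemma ev_X_inr {n : ℕ} (j : Fin n) (z : Ez n) : ev (X (Sum.inr j)) z = starRingEnd ℂ (z j) := by
  simp [ev, cv]

lemma ev_cj {n : ℕ} (P : Pol n) (z : Ez n) : ev (cj P) z = starRingEnd ℂ (ev P z) := by
  unfold ev cj
  rw [eval_rename, eval_map, ← coe_eval₂Hom]
  have : (starRingEnd ℂ) (eval (cv z) P) = (starRingEnd ℂ).comp (eval (cv z)) P := rfl
  rw [this]
  congr 1
  apply MvPolynomial.ringHom_ext
  · intro r; simp
  · rintro (i | i) <;> simp [cv]

lemma ev_rr {n : ℕ} (z : Ez n) : ev (rr n) z = ((‖z‖ ^ 2 : ℝ) : ℂ) := by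
  simp only [rr, ev_sum, ev_mul, ev_X_inl, ev_X_inr, EuclideanSpace.norm_sq_eq]
  push_cast
  refine Finset.sum_congr rfl fun j _ => ?_
  rw [Complex.mul_conj, Complex.normSq_eq_norm_sq]; push_cast; rfl

lemma ev_smul {n p q : ℕ} {P : Pol n} (h : BH P p q) (c : ℂ) (z : Ez n) :
    ev P (c • z) = c ^ p * (starRingEnd ℂ c) ^ q * ev P z := by
  unfold ev
  rw [eval_eq', eval_eq', Finset.mul_sum]
  refine Finset.sum_congr rfl fun d hd => ?_
  have h1 := h (mem_support_iff.1 hd)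
  have hp := congrArg Prod.fst h1
  have hq := congrArg Prod.snd h1
  simp [Finsupp.weight_apply, Finsupp.sum_fintype, bw, Prod.fst_sum, Prod.snd_sum] at hp hq
  simp only [Fintype.prod_sum_type, cv, Sum.elim_inl, Sum.elim_inr, PiLp.smul_apply, smul_eq_mul,
    map_mul, mul_pow, Finset.prod_mul_distrib, Finset.prod_pow_eq_pow_sum, hp, hq]
  ring

lemma ev_real_smul {n p q : ℕ} {P : Pol n} (h : BH P p q) (c : ℝ) (z : Ez n) :
    ev P (c • z) = (c : ℂ) ^ (p + q) * ev P z := by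
  have : c • z = (c : ℂ) • z := by ext j; simp
  rw [this, ev_smul h]; simp [pow_add]

/-- directional derivative polynomial -/
def Dv {n : ℕ} (v : Ez n) (P : Pol n) : Pol n :=
  ∑ j : Fin n, (C (v j) * pderiv (Sum.inl j) P + C (starRingEnd ℂ (v j)) * pderiv (Sum.inr j) P)

def coordR {n : ℕ} (j : Fin n) : Ez n →L[ℝ] ℂ := (EuclideanSpace.proj j : Ez n →L[ℂ] ℂ).restrictScalars ℝ

def evD {n : ℕ} (P : Pol n) (z : Ez n) : Ez n →L[ℝ] ℂ :=
  ∑ j : Fin n, (ev (pderiv (Sum.inl j) P) z • coordR j +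
    ev (pderiv (Sum.inr j) P) z • ((Complex.conjCLE : ℂ →L[ℝ] ℂ).comp (coordR j)))

lemma evD_apply {n : ℕ} (P : Pol n) (z v : Ez n) : evD P z v = ev (Dv v P) z := by
  simp [evD, Dv, coordR, mul_comm]

lemma hasFDerivAt_ev {n : ℕ} (P : Pol n) (z : Ez n) : HasFDerivAt (ev P) (evD P z) z := by
  induction P using MvPolynomial.induction_on with
  | C a =>
    have : evD (C a) z = 0 := by ext v; simp [evD]
    rw [this]
    have h2 : ev (C a : Pol n) = fun _ => a := by ext; simp
    rw [h2]; exact hasFDerivAt_const _ _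
  | add P Q hP hQ =>
    have : evD (P + Q) z = evD P z + evD Q z := by
      ext v; simp [evD_apply, Dv, mul_add, Finset.sum_add_distrib]; ring
    rw [this]
    have h2 : ev (P + Q) = ev P + ev Q := by ext; simp
    rw [h2]; exact hP.add hQ
  | mul_X P i hP =>
    have h2 : ev (P * X i) = fun z => ev P z * ev (X i) z := by ext; simp
    have hX : HasFDerivAt (ev (X i : Pol n)) (evD (X i) z) z := by
      rcases i with i | i
      · have h3 : ev (X (Sum.inl i) : Pol n) = coordR i := by ext; simp [coordR]
        have h4 : evD (X (Sum.inl i) : Pol n) z = coordR i := by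
          ext v; rw [evD_apply]; simp [Dv, pderiv_X, Pi.single_apply, ev, coordR]
        rw [h3, h4]; exact (coordR i).hasFDerivAt
      · have h3 : ev (X (Sum.inr i) : Pol n) = ((Complex.conjCLE : ℂ →L[ℝ] ℂ).comp (coordR i)) := by
          ext; simp [coordR]
        have h4 : evD (X (Sum.inr i) : Pol n) z = ((Complex.conjCLE : ℂ →L[ℝ] ℂ).comp (coordR i)) := by
          ext v; rw [evD_apply]; simp [Dv, pderiv_X, Pi.single_apply, ev, coordR]
        rw [h3, h4]; exact ContinuousLinearMap.hasFDerivAt _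
    rw [h2]
    refine (hP.mul hX).congr_fderiv ?_
    ext v
    simp [evD_apply, Dv, Derivation.leibniz, Finset.mul_sum, ← Finset.sum_add_distrib]
    refine Finset.sum_congr rfl fun j _ => ?_
    ring

lemma fderiv_ev {n : ℕ} (P : Pol n) (z v : Ez n) : fderiv ℝ (ev P) z v = ev (Dv v P) z := by
  rw [(hasFDerivAt_ev P z).fderiv, evD_apply]

lemma contDiff_ev {n : ℕ} (P : Pol n) (m : WithTop ℕ∞) : ContDiff ℝ m (ev P) := by
  induction P using MvPolynomial.induction_on with
  | C a =>
    have h2 : ev (C a : Pol n) = fun _ => a := by ext; simp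
    rw [h2]; exact contDiff_const
  | add P Q hP hQ =>
    have h2 : ev (P + Q) = ev P + ev Q := by ext; simp
    rw [h2]; exact hP.add hQ
  | mul_X P i hP =>
    have h2 : ev (P * X i) = fun z => ev P z * ev (X i) z := by ext; simp
    rw [h2]
    refine hP.mul ?_
    rcases i with i | i
    · have h3 : ev (X (Sum.inl i) : Pol n) = coordR i := by ext; simp [coordR]
      rw [h3]; exact (coordR i).contDiff
    · have h3 : ev (X (Sum.inr i) : Pol n) = ((Complex.conjCLE : ℂ →L[ℝ] ℂ).comp (coordR i)) := by
        ext; simp [coordR]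
      rw [h3]; exact ContinuousLinearMap.contDiff _

lemma continuous_ev {n : ℕ} (P : Pol n) : Continuous (ev P) := (contDiff_ev P 0).continuous

def b1 {n : ℕ} (j : Fin n) : Ez n := EuclideanSpace.single j 1
def b2 {n : ℕ} (j : Fin n) : Ez n := Complex.I • EuclideanSpace.single j 1

lemma Dv_b1 {n : ℕ} (j : Fin n) (P : Pol n) :
    Dv (b1 j) P = pderiv (Sum.inl j) P + pderiv (Sum.inr j) P := by
  unfold Dv
  rw [Finset.sum_eq_single j]
  · simp [b1]
  · intro k _ hk; simp [b1, hk]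
  · simp
lemma Dv_b2 {n : ℕ} (j : Fin n) (P : Pol n) :
    Dv (b2 j) P = C Complex.I * (pderiv (Sum.inl j) P - pderiv (Sum.inr j) P) := by
  unfold Dv
  rw [Finset.sum_eq_single j]
  · simp [b2]; ring
  · intro k _ hk; simp [b2, hk]
  · simp

lemma Dv_Dv {n : ℕ} (P : Pol n) :
    ∑ j : Fin n, (Dv (b1 j) (Dv (b1 j) P) + Dv (b2 j) (Dv (b2 j) P)) = C 4 * Lap P := by
  unfold Lap
  rw [Finset.mul_sum]
  refine Finset.sum_congr rfl fun j _ => ?_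
  simp only [Dv_b1, Dv_b2, map_add, pderiv_C_mul, map_sub, pderiv_comm_pol P (Sum.inr j) (Sum.inl j)]
  have : (C Complex.I : Pol n) * C Complex.I = -1 := by rw [← C_mul]; simp
  have h4 : (C 4 : Pol n) = 4 := map_ofNat C 4
  rw [h4]
  linear_combination (pderiv (Sum.inl j) (pderiv (Sum.inl j) P) + pderiv (Sum.inr j) (pderiv (Sum.inr j) P) - 2 * pderiv (Sum.inl j) (pderiv (Sum.inr j) P)) * this

lemma cplxLaplacian_ev {n : ℕ} (P : Pol n) (z : Ez n) : cplxLaplacian (ev P) z = 4 * ev (Lap P) z := by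
  have := congrArg (fun Q => ev Q z) (Dv_Dv P)
  simp only [ev_sum, ev_add, ev_mul, ev_C] at this
  rw [← this]
  unfold cplxLaplacian
  refine Finset.sum_congr rfl fun j _ => ?_
  simp only [fderiv_ev]
  rfl

lemma memHpq_ev {n p q : ℕ} {P : Pol n} (h : BH P p q) (hL : Lap P = 0) : MemHpq n p q (ev P) := by
  refine ⟨contDiff_ev _ _, fun z => ?_, fun c z => ev_smul h c z⟩
  rw [cplxLaplacian_ev, hL]; simp

lemma fderiv_sq {n : ℕ} (z : Ez n) :
    HasFDerivAt (fun z : Ez n => ‖z‖ ^ 2) (Complex.reCLM.comp (evD (rr n) z)) z := by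
  have h := Complex.reCLM.hasFDerivAt.comp z (hasFDerivAt_ev (rr n) z)
  refine h.congr_of_eventuallyEq (Filter.Eventually.of_forall fun w => ?_)
  simp only [Function.comp, Complex.reCLM_apply]
  rw [ev_rr, Complex.ofReal_re]

lemma re_evD_rr_b1 {n : ℕ} (z : Ez n) (j : Fin n) : Complex.reCLM (evD (rr n) z (b1 j)) = 2 * (z j).re := by
  rw [evD_apply, Dv_b1, pderiv_inl_rr, pderiv_inr_rr]; simp; ring
lemma re_evD_rr_b2 {n : ℕ} (z : Ez n) (j : Fin n) : Complex.reCLM (evD (rr n) z (b2 j)) = 2 * (z j).im := by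
  rw [evD_apply, Dv_b2, pderiv_inl_rr, pderiv_inr_rr]; simp; ring

/-- Euler's identity in basis form. -/
lemma euler {n p q : ℕ} {P : Pol n} (h : BH P p q) (z : Ez n) :
    ∑ j : Fin n, (((2 * (z j).re : ℝ) : ℂ) * ev (Dv (b1 j) P) z + ((2 * (z j).im : ℝ) : ℂ) * ev (Dv (b2 j) P) z)
      = 2 * (p + q : ℕ) * ev P z := by
  have he := congrArg (fun Q => ev Q z) h.isHomogeneous.sum_X_mul_pderiv
  simp only [Fintype.sum_sum_type, ev_sum, ev_mul, ev_X_inl, ev_X_inr, ev_add, nsmul_eq_mul] at he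
  have : ev ((p + q : ℕ) : Pol n) z = (p + q : ℕ) := by simp [ev]
  rw [this, ← Finset.sum_add_distrib] at he
  rw [mul_assoc, ← he, Finset.mul_sum]
  refine Finset.sum_congr rfl fun j _ => ?_
  rw [Dv_b1, Dv_b2]
  simp only [ev_mul, ev_add, ev_sub, ev_C]
  have h1 : z j = (z j).re + (z j).im * Complex.I := (Complex.re_add_im _).symm
  have h2 : starRingEnd ℂ (z j) = (z j).re - (z j).im * Complex.I := by
    apply Complex.ext <;> simp
  rw [h2]
  nth_rewrite 3 [h1]
  push_cast
  ring



def m0 (n : ℕ) : Measure (Ez n) := Measure.addHaar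
instance (n : ℕ) : (m0 n).IsAddHaarMeasure := by unfold m0; infer_instance

def thw (s : ℝ) : ℝ := max 0 ((s - 1) * (4 - s))
lemma thw_nonneg (s : ℝ) : 0 ≤ thw s := le_max_left _ _
lemma continuous_thw : Continuous thw := by unfold thw; fun_prop
lemma thw_eq_zero_of_le {s : ℝ} (h : s ≤ 1) : thw s = 0 := max_eq_left (by nlinarith)
lemma thw_eq_zero_of_ge {s : ℝ} (h : 4 ≤ s) : thw s = 0 := max_eq_left (by nlinarith)
lemma thw_pos {s : ℝ} (h : 1 < s) (h' : s < 4) : 0 < thw s :=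
  lt_max_of_lt_right (mul_pos (by linarith) (by linarith))
lemma thw_le (s : ℝ) : thw s ≤ 3 := max_le (by norm_num) (by nlinarith [sq_nonneg (s - 5/2)])

def rho {n : ℕ} (x : Ez n) : Ez n := (‖x‖⁻¹ : ℝ) • x

lemma measurable_rho {n : ℕ} : Measurable (rho (n := n)) := by
  have h1 : Measurable (fun x : Ez n => (‖x‖⁻¹ : ℝ)) := by
    have : Measurable (fun x : Ez n => ‖x‖) := continuous_norm.measurable
    exact this.inv
  have hc : Continuous (fun y : ℝ × Ez n => y.1 • y.2) := continuous_fst.smul continuous_snd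
  unfold rho
  exact hc.measurable.comp (h1.prodMk measurable_id)

def dens {n : ℕ} (x : Ez n) : ℝ := thw (‖x‖ ^ 2)
lemma continuous_dens {n : ℕ} : Continuous (dens (n := n)) := continuous_thw.comp (by fun_prop)
lemma dens_zero_of_large {n : ℕ} {x : Ez n} (h : x ∉ closedBall (0 : Ez n) 2) : dens x = 0 := by
  apply thw_eq_zero_of_ge
  simp at h
  nlinarith
lemma dens_zero_of_small {n : ℕ} {x : Ez n} (h : ‖x‖ ≤ 1) : dens x = 0 := by
  apply thw_eq_zero_of_le
  nlinarith [norm_nonneg x]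

lemma hcs {n : ℕ} {F : Type*} [Zero F] {f : Ez n → F} (h : ∀ x, x ∉ closedBall (0 : Ez n) 2 → f x = 0) :
    HasCompactSupport f := HasCompactSupport.intro (isCompact_closedBall 0 2) h

lemma integrable_dens {n : ℕ} : Integrable (dens (n := n)) (m0 n) :=
  continuous_dens.integrable_of_hasCompactSupport (hcs fun _ => dens_zero_of_large)

def sg0 (n : ℕ) : Measure (Ez n) := (m0 n).withDensity (fun x => ENNReal.ofReal (dens x))
def sg (n : ℕ) : Measure (Ez n) := Measure.map rho (sg0 n)

instance (n : ℕ) : IsFiniteMeasure (sg0 n) := by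
  unfold sg0
  exact isFiniteMeasure_withDensity_ofReal integrable_dens.2
instance (n : ℕ) : IsFiniteMeasure (sg n) := by unfold sg; infer_instance

lemma sg0_ae {n : ℕ} : ∀ᵐ x ∂(sg0 n), 1 < ‖x‖ ∧ ‖x‖ < 2 := by
  unfold sg0
  have hm : Measurable (fun x : Ez n => ENNReal.ofReal (dens x)) :=
    ENNReal.measurable_ofReal.comp continuous_dens.measurable
  rw [ae_withDensity_iff hm]
  refine Filter.Eventually.of_forall fun x hx => ?_
  constructor
  · by_contra h
    exact hx (by rw [dens_zero_of_small (not_lt.1 h)]; simp)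
  · by_contra h
    apply hx
    have : dens x = 0 := thw_eq_zero_of_ge (by nlinarith [not_lt.1 h])
    rw [this]; simp

lemma norm_rho {n : ℕ} {x : Ez n} (h : 1 < ‖x‖) : ‖rho x‖ = 1 := by
  unfold rho
  rw [norm_smul, norm_inv, norm_norm, inv_mul_cancel₀ (by linarith)]

lemma sg_ae {n : ℕ} : ∀ᵐ x ∂(sg n), x ∈ unitSphere n := by
  unfold sg
  have hm : MeasurableSet {x : Ez n | x ∈ unitSphere n} := (isClosed_sphere (x := (0 : Ez n)) (ε := 1)).measurableSet
  rw [ae_map_iff measurable_rho.aemeasurable hm]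
  filter_upwards [sg0_ae] with x hx
  simp [unitSphere, norm_rho hx.1]

lemma integral_sg {n : ℕ} {g : Ez n → ℂ} (hg : Continuous g) :
    ∫ z, g z ∂(sg n) = ∫ x, (dens x : ℂ) * g (rho x) ∂(m0 n) := by
  unfold sg sg0
  rw [integral_map measurable_rho.aemeasurable hg.aestronglyMeasurable]
  have : (fun x : Ez n => ENNReal.ofReal (dens x)) = fun x => ((dens x).toNNReal : ℝ≥0∞) := rfl
  rw [this, integral_withDensity_eq_integral_smul (continuous_dens.measurable.real_toNNReal)]
  refine integral_congr_ae (Filter.Eventually.of_forall fun x => ?_)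
  simp only [NNReal.smul_def]
  rw [Real.coe_toNNReal (dens x) (thw_nonneg _)]
  simp

lemma integral_fderiv_zero {n : ℕ} {F : Ez n → ℂ} {F' : Ez n → (Ez n →L[ℝ] ℂ)} (v : Ez n)
    (hF : ∀ x, HasFDerivAt F (F' x) x) (hc : Continuous fun x => F' x v)
    (h0 : ∀ x, x ∉ closedBall (0 : Ez n) 2 → F x = 0)
    (h1 : ∀ x, x ∉ closedBall (0 : Ez n) 2 → F' x v = 0) :
    ∫ x, F' x v ∂(m0 n) = 0 := by
  have i0 : Integrable F (m0 n) := by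
    apply Continuous.integrable_of_hasCompactSupport
    · exact continuous_iff_continuousAt.2 fun x => (hF x).continuousAt
    · exact hcs h0
  have i1 : Integrable (fun x => F' x v) (m0 n) := hc.integrable_of_hasCompactSupport (hcs h1)
  have := integral_bilinear_hasFDerivAt_right_eq_neg_left_of_integrable (μ := m0 n) (v := v)
    (f := fun _ : Ez n => (1 : ℂ)) (f' := fun _ => 0) (g := F) (g' := F')
    (B := ContinuousLinearMap.mul ℝ ℂ) (by simp) (by simpa using i1) (by simpa using i0)
    (fun x _ => hasFDerivAt_const _ _) (fun x _ => hF x)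
  simpa using this

lemma orth_aux {n p q p' q' : ℕ} {P Q : Pol n} (hP : BH P p q) (hQ : BH Q p' q')
    (hLP : Lap P = 0) (hLQ : Lap Q = 0) (hne : p + q ≠ p' + q') (th : ℝ → ℝ) (hth : Continuous th)
    (hth0 : ∀ s, 4 ≤ s → th s = 0) :
    ∫ x, (th (‖x‖ ^ 2) : ℂ) * (ev P x * ev Q x) ∂(m0 n) = 0 := by
  set W : ℝ → ℝ := fun s => ∫ t in (4 : ℝ)..s, th t with hW
  have hWd : ∀ s, HasDerivAt W (th s) s := fun s =>
    intervalIntegral.integral_hasDerivAt_right (hth.intervalIntegrable _ _)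
      hth.aestronglyMeasurable.stronglyMeasurableAtFilter hth.continuousAt
  have hW0 : ∀ s, 4 ≤ s → W s = 0 := by
    intro s hs
    apply intervalIntegral.integral_zero_ae
    refine Filter.Eventually.of_forall fun t ht => hth0 t ?_
    rw [uIoc_of_le hs] at ht
    exact ht.1.le
  have hWc : Continuous W := continuous_iff_continuousAt.2 fun s => (hWd s).continuousAt
  have hbig : ∀ x : Ez n, x ∉ closedBall (0 : Ez n) 2 → 4 ≤ ‖x‖ ^ 2 := by
    intro x hx; simp at hx; nlinarith
  -- the divergence of one component
  have comp : ∀ v : Ez n, ∫ x, ((th (‖x‖ ^ 2) * Complex.reCLM (evD (rr n) x v) : ℝ) : ℂ) *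
        (ev P x * ev (Dv v Q) x - ev Q x * ev (Dv v P) x)
        + (W (‖x‖ ^ 2) : ℂ) * (ev P x * ev (Dv v (Dv v Q)) x - ev Q x * ev (Dv v (Dv v P)) x) ∂(m0 n) = 0 := by
    intro v
    have hd : ∀ x, HasFDerivAt (fun x : Ez n => (W (‖x‖ ^ 2) : ℂ) * (ev P x * ev (Dv v Q) x - ev Q x * ev (Dv v P) x))
      ((W (‖x‖ ^ 2) : ℂ) • ((ev P x • evD (Dv v Q) x + ev (Dv v Q) x • evD P x)
          - (ev Q x • evD (Dv v P) x + ev (Dv v P) x • evD Q x))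
        + (ev P x * ev (Dv v Q) x - ev Q x * ev (Dv v P) x) •
          (Complex.ofRealCLM.comp ((th (‖x‖ ^ 2)) • (Complex.reCLM.comp (evD (rr n) x))))) x := by
      intro x
      have hw : HasFDerivAt (fun x : Ez n => (W (‖x‖ ^ 2) : ℂ))
          (Complex.ofRealCLM.comp ((th (‖x‖ ^ 2)) • (Complex.reCLM.comp (evD (rr n) x)))) x :=
        Complex.ofRealCLM.hasFDerivAt.comp x ((hWd _).comp_hasFDerivAt x (fderiv_sq x))
      exact hw.mul (((hasFDerivAt_ev P x).mul (hasFDerivAt_ev (Dv v Q) x)).sub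
        ((hasFDerivAt_ev Q x).mul (hasFDerivAt_ev (Dv v P) x)))
    have heq : ∀ x, ((W (‖x‖ ^ 2) : ℂ) • ((ev P x • evD (Dv v Q) x + ev (Dv v Q) x • evD P x)
          - (ev Q x • evD (Dv v P) x + ev (Dv v P) x • evD Q x))
        + (ev P x * ev (Dv v Q) x - ev Q x * ev (Dv v P) x) •
          (Complex.ofRealCLM.comp ((th (‖x‖ ^ 2)) • (Complex.reCLM.comp (evD (rr n) x))))) v
        = ((th (‖x‖ ^ 2) * Complex.reCLM (evD (rr n) x v) : ℝ) : ℂ) *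
        (ev P x * ev (Dv v Q) x - ev Q x * ev (Dv v P) x)
        + (W (‖x‖ ^ 2) : ℂ) * (ev P x * ev (Dv v (Dv v Q)) x - ev Q x * ev (Dv v (Dv v P)) x) := by
      intro x
      simp only [add_apply, smul_apply,
        sub_apply, ContinuousLinearMap.comp_apply, Complex.ofRealCLM_apply, evD_apply,
        smul_eq_mul]
      ring
    have hz := integral_fderiv_zero v hd ?_ ?_ ?_
    · simp only [heq] at hz; exact hz
    · simp only [heq]
      have c1 : Continuous fun x : Ez n => Complex.reCLM (evD (rr n) x v) := by
        simp only [evD_apply]; exact Complex.reCLM.continuous.comp (continuous_ev _)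
      have cn : Continuous fun x : Ez n => ‖x‖ ^ 2 := by fun_prop
      exact ((Complex.continuous_ofReal.comp ((hth.comp cn).mul c1)).mul
        (((continuous_ev _).mul (continuous_ev _)).sub ((continuous_ev _).mul (continuous_ev _)))).add
        ((Complex.continuous_ofReal.comp (hWc.comp cn)).mul
        (((continuous_ev _).mul (continuous_ev _)).sub ((continuous_ev _).mul (continuous_ev _))))
    · intro x hx; simp [hW0 _ (hbig x hx)]
    · intro x hx; rw [heq]; simp [hW0 _ (hbig x hx), hth0 _ (hbig x hx)]
  have cint : ∀ v : Ez n, Integrable (fun x => ((th (‖x‖ ^ 2) * Complex.reCLM (evD (rr n) x v) : ℝ) : ℂ) *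
        (ev P x * ev (Dv v Q) x - ev Q x * ev (Dv v P) x)
        + (W (‖x‖ ^ 2) : ℂ) * (ev P x * ev (Dv v (Dv v Q)) x - ev Q x * ev (Dv v (Dv v P)) x)) (m0 n) := by
    intro v
    apply Continuous.integrable_of_hasCompactSupport
    · have c1 : Continuous fun x : Ez n => Complex.reCLM (evD (rr n) x v) := by
        simp only [evD_apply]; exact Complex.reCLM.continuous.comp (continuous_ev _)
      have cn : Continuous fun x : Ez n => ‖x‖ ^ 2 := by fun_prop
      exact ((Complex.continuous_ofReal.comp ((hth.comp cn).mul c1)).mul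
        (((continuous_ev _).mul (continuous_ev _)).sub ((continuous_ev _).mul (continuous_ev _)))).add
        ((Complex.continuous_ofReal.comp (hWc.comp cn)).mul
        (((continuous_ev _).mul (continuous_ev _)).sub ((continuous_ev _).mul (continuous_ev _))))
    · apply hcs
      intro x hx; simp [hW0 _ (hbig x hx), hth0 _ (hbig x hx)]
  have hsum : ∫ x, (2 * ((p' + q' : ℕ) - (p + q : ℕ) : ℂ)) * ((th (‖x‖ ^ 2) : ℂ) * (ev P x * ev Q x)) ∂(m0 n) = 0 := by
    have : ∫ x, ∑ j : Fin n, ((((th (‖x‖ ^ 2) * Complex.reCLM (evD (rr n) x (b1 j)) : ℝ) : ℂ) *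
        (ev P x * ev (Dv (b1 j) Q) x - ev Q x * ev (Dv (b1 j) P) x)
        + (W (‖x‖ ^ 2) : ℂ) * (ev P x * ev (Dv (b1 j) (Dv (b1 j) Q)) x - ev Q x * ev (Dv (b1 j) (Dv (b1 j) P)) x))
        + (((th (‖x‖ ^ 2) * Complex.reCLM (evD (rr n) x (b2 j)) : ℝ) : ℂ) *
        (ev P x * ev (Dv (b2 j) Q) x - ev Q x * ev (Dv (b2 j) P) x)
        + (W (‖x‖ ^ 2) : ℂ) * (ev P x * ev (Dv (b2 j) (Dv (b2 j) Q)) x - ev Q x * ev (Dv (b2 j) (Dv (b2 j) P)) x)))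
        ∂(m0 n) = 0 := by
      rw [integral_finsetSum]
      · apply Finset.sum_eq_zero
        intro j _
        rw [integral_add (cint _) (cint _), comp, comp, add_zero]
      · intro j _
        exact (cint _).add (cint _)
    rw [← this]
    refine integral_congr_ae (Filter.Eventually.of_forall fun x => ?_)
    simp only [re_evD_rr_b1, re_evD_rr_b2]
    have eP := euler hP x
    have eQ := euler hQ x
    have lP := congrArg (fun Q => ev Q x) (Dv_Dv P)
    have lQ := congrArg (fun Q => ev Q x) (Dv_Dv Q)
    simp only [hLP, hLQ, mul_zero, ev_zero, ev_sum, ev_add] at lP lQ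
    calc _ = (th (‖x‖ ^ 2) : ℂ) * (ev P x * (2 * (p' + q' : ℕ) * ev Q x) - ev Q x * (2 * (p + q : ℕ) * ev P x))
          + (W (‖x‖ ^ 2) : ℂ) * (ev P x * 0 - ev Q x * 0) := by ring
      _ = _ := by
        rw [← eP, ← eQ]
        nth_rewrite 1 [← lQ]
        rw [← lP]
        simp only [Finset.mul_sum, ← Finset.sum_sub_distrib, ← Finset.sum_add_distrib]
        refine Finset.sum_congr rfl fun j _ => ?_
        push_cast
        ring
  rw [integral_const_mul] at hsum
  rcases mul_eq_zero.1 hsum with h | h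
  · exfalso
    have h3 : ((p' + q' : ℕ) : ℂ) = ((p + q : ℕ) : ℂ) := by linear_combination h / 2
    exact hne (by exact_mod_cast h3.symm)
  · exact h

lemma orth {n p q p' q' : ℕ} {P Q : Pol n} (hP : BH P p q) (hQ : BH Q p' q')
    (hLP : Lap P = 0) (hLQ : Lap Q = 0) (hne : p + q ≠ p' + q') :
    ∫ z, ev P z * ev Q z ∂(sg n) = 0 := by
  rw [integral_sg (g := fun z => ev P z * ev Q z) ((continuous_ev P).mul (continuous_ev Q))]
  set th : ℝ → ℝ := fun s => thw s * ((Real.sqrt (max s 1))⁻¹) ^ (p + q + (p' + q')) with hth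
  have hc : Continuous th := by
    refine continuous_thw.mul (Continuous.pow ?_ _)
    refine Continuous.inv₀ (by fun_prop) fun s => ?_
    have : 0 < max s 1 := lt_max_of_lt_right one_pos
    exact (Real.sqrt_pos.2 this).ne'
  rw [← orth_aux hP hQ hLP hLQ hne th hc (fun s hs => by simp [hth, thw_eq_zero_of_ge hs])]
  refine integral_congr_ae (Filter.Eventually.of_forall fun x => ?_)
  simp only [hth, dens]
  by_cases h : ‖x‖ ^ 2 ≤ 1
  · simp [thw_eq_zero_of_le h]
  · rw [max_eq_left (not_le.1 h).le, Real.sqrt_sq (norm_nonneg x)]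
    unfold rho
    rw [ev_real_smul hP, ev_real_smul hQ]
    push_cast
    ring


lemma integrable_cont_mul {n : ℕ} {μ : Measure (Ez n)} (hμ : ∀ᵐ x ∂μ, x ∈ unitSphere n)
    {g f : Ez n → ℂ} (hg : Continuous g) (hf : Integrable f μ) :
    Integrable (fun x => g x * f x) μ := by
  obtain ⟨C, hC⟩ := (isCompact_sphere (0 : Ez n) 1).exists_bound_of_continuousOn hg.continuousOn
  refine hf.bdd_mul hg.aestronglyMeasurable (c := C) ?_
  filter_upwards [hμ] with x hx
  exact hC x hx

lemma integrable_cont {n : ℕ} {μ : Measure (Ez n)} [IsFiniteMeasure μ] (hμ : ∀ᵐ x ∂μ, x ∈ unitSphere n)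
    {g : Ez n → ℂ} (hg : Continuous g) : Integrable g μ := by
  simpa using integrable_cont_mul hμ hg (integrable_const (1 : ℂ))

lemma pos_aux {n p q : ℕ} {P : Pol n} (h : BH P p q)
    (h0 : ∫ z, ev P z * ev (cj P) z ∂(sg n) = 0) {z : Ez n} (hz : z ∈ unitSphere n) : ev P z = 0 := by
  by_contra hne
  have hc : Continuous (fun z => ‖ev P z‖ ^ 2) := (continuous_ev P).norm.pow 2
  have h1 : ∫ z, ‖ev P z‖ ^ 2 ∂(sg n) = 0 := by
    have : ∀ z, ev P z * ev (cj P) z = ((‖ev P z‖ ^ 2 : ℝ) : ℂ) := by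
      intro z
      rw [ev_cj, Complex.mul_conj, Complex.normSq_eq_norm_sq]
    simp_rw [this] at h0
    have h0' := h0
    rw [integral_complex_ofReal] at h0'
    exact_mod_cast h0'
  have hi : Integrable (fun z => ‖ev P z‖ ^ 2) (sg n) := by
    have := (integrable_cont sg_ae (g := fun z => ((‖ev P z‖ ^ 2 : ℝ) : ℂ)) (Complex.continuous_ofReal.comp hc)).re
    refine this.congr (Filter.Eventually.of_forall fun x => ?_)
    exact Complex.ofReal_re _
  rw [integral_eq_zero_iff_of_nonneg (fun _ => by positivity) hi] at h1
  have h2 : ∀ᵐ z ∂(sg n), ev P z = 0 := by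
    filter_upwards [h1] with z hz
    simpa using hz
  have hm : MeasurableSet {x : Ez n | ev P x = 0} := (isClosed_eq (continuous_ev P) continuous_const).measurableSet
  unfold sg at h2
  rw [ae_map_iff measurable_rho.aemeasurable hm] at h2
  unfold sg0 at h2
  have hmd : Measurable (fun x : Ez n => ENNReal.ofReal (dens x)) :=
    ENNReal.measurable_ofReal.comp continuous_dens.measurable
  rw [ae_withDensity_iff hmd] at h2
  set U : Set (Ez n) := {x | 1 < ‖x‖ ∧ ‖x‖ < 2 ∧ ev P x ≠ 0} with hU
  have hUo : IsOpen U := by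
    refine (isOpen_lt continuous_const continuous_norm).inter
      ((isOpen_lt continuous_norm continuous_const).inter ?_)
    exact isOpen_ne_fun (continuous_ev P) continuous_const
  have hz1 : ‖z‖ = 1 := by simpa [unitSphere] using hz
  have hUne : U.Nonempty := by
    refine ⟨(3/2 : ℝ) • z, ?_, ?_, ?_⟩
    · rw [norm_smul, hz1]; norm_num
    · rw [norm_smul, hz1]; norm_num
    · rw [ev_real_smul h]
      refine mul_ne_zero (pow_ne_zero _ ?_) hne
      norm_num
  have hpos := hUo.measure_pos (m0 n) hUne
  refine hpos.ne' ?_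
  refine measure_mono_null (fun x hx => ?_) h2
  obtain ⟨ha, hb, hcc⟩ := hx
  simp only [mem_compl_iff, mem_ofPred_eq]
  intro hh
  have hd : ENNReal.ofReal (dens x) ≠ 0 := by
    rw [Ne, ENNReal.ofReal_eq_zero, not_le]
    exact thw_pos (by nlinarith) (by nlinarith)
  have := hh hd
  unfold rho at this
  rw [ev_real_smul h] at this
  rcases mul_eq_zero.1 this with h3 | h3
  · have : ((‖x‖⁻¹ : ℝ) : ℂ) ≠ 0 := by
      rw [Complex.ofReal_ne_zero]; exact inv_ne_zero (by linarith)
    exact pow_ne_zero _ this h3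
  · exact hcc h3

def Vh (n p q : ℕ) : Submodule ℂ (Pol n) where
  carrier := {P | BH P p q ∧ Lap P = 0}
  add_mem' := fun ha hb => ⟨ha.1.add hb.1, by rw [Lap_add, ha.2, hb.2, add_zero]⟩
  zero_mem' := ⟨BH_zero, by simp [Lap]⟩
  smul_mem' := fun c P h => by
    rw [MvPolynomial.smul_eq_C_mul]
    exact ⟨h.1.C_mul c, by rw [Lap_C_mul, h.2, mul_zero]⟩

instance (n p q : ℕ) : FiniteDimensional ℂ (Vh n p q) := by
  have hle : Vh n p q ≤ restrictTotalDegree (Fin n ⊕ Fin n) ℂ (p + q) := by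
    intro P hP
    rw [mem_restrictTotalDegree]
    exact hP.1.isHomogeneous.totalDegree_le
  exact Submodule.finiteDimensional_of_le hle

lemma ev_smul_left {n : ℕ} (c : ℂ) (P : Pol n) (z : Ez n) : ev (c • P) z = c * ev P z := by
  rw [MvPolynomial.smul_eq_C_mul, ev_mul, ev_C]

/-- integration against `u` as a functional. -/
def Lam {n : ℕ} (μ : Measure (Ez n)) (hμ : ∀ᵐ x ∂μ, x ∈ unitSphere n) (u : Ez n → ℂ)
    (hu : Integrable u μ) (V : Submodule ℂ (Pol n)) : Module.Dual ℂ V where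
  toFun h := ∫ z, ev (h : Pol n) z * u z ∂μ
  map_add' := fun a b => by
    rw [← integral_add (integrable_cont_mul hμ (continuous_ev _) hu) (integrable_cont_mul hμ (continuous_ev _) hu)]
    congr 1; ext z; simp; ring
  map_smul' := fun c a => by
    simp only [Submodule.coe_smul, ev_smul_left, RingHom.id_apply, smul_eq_mul]
    rw [← integral_const_mul]
    congr 1; ext z; ring

lemma sg_cont {n : ℕ} {g : Ez n → ℂ} (hg : Continuous g) : Integrable g (sg n) := integrable_cont sg_ae hg

def Bm (n p q : ℕ) : Vh n q p →ₗ[ℂ] Module.Dual ℂ (Vh n p q) where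
  toFun g := Lam (sg n) sg_ae (ev (g : Pol n)) (sg_cont (continuous_ev _)) (Vh n p q)
  map_add' := fun a b => by
    ext h
    simp only [Lam, LinearMap.coe_mk, AddHom.coe_mk, LinearMap.add_apply]
    rw [← integral_add (integrable_cont_mul sg_ae (continuous_ev _) (sg_cont (continuous_ev _))) (integrable_cont_mul sg_ae (continuous_ev _) (sg_cont (continuous_ev _)))]
    congr 1; ext z; simp; ring
  map_smul' := fun c a => by
    ext h
    simp only [Lam, LinearMap.coe_mk, AddHom.coe_mk, LinearMap.smul_apply, Submodule.coe_smul, ev_smul_left, RingHom.id_apply, smul_eq_mul]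
    rw [← integral_const_mul]
    congr 1; ext z; ring

lemma riesz {n : ℕ} (p q : ℕ) {ν : Measure (Ez n)} (hν : ∀ᵐ x ∂ν, x ∈ unitSphere n)
    {f : Ez n → ℂ} (hf : Integrable f ν) :
    ∃ g : Pol n, BH g q p ∧ Lap g = 0 ∧ ∀ h : Pol n, BH h p q → Lap h = 0 →
      ∫ z, ev h z * f z ∂ν = ∫ z, ev h z * ev g z ∂(sg n) := by
  have key : Lam ν hν f hf (Vh n p q) ∈ LinearMap.range (Bm n p q) := by
    rw [← Subspace.dualCoannihilator_dualAnnihilator_eq (W := LinearMap.range (Bm n p q))]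
    rw [Submodule.mem_dualAnnihilator]
    intro h hh
    rw [Submodule.mem_dualCoannihilator] at hh
    have h1 := hh _ (LinearMap.mem_range_self (Bm n p q) ⟨cj h.1, cj_BH h.2.1, cj_Lap h.2.2⟩)
    have h2 : ∀ z ∈ unitSphere n, ev h.1 z = 0 := fun z hz => pos_aux h.2.1 h1 hz
    change ∫ z, ev h.1 z * f z ∂ν = 0
    refine integral_eq_zero_of_ae ?_
    filter_upwards [hν] with z hz
    simp [h2 z hz]
  obtain ⟨g, hg⟩ := key
  refine ⟨g.1, g.2.1, g.2.2, fun h hh hL => ?_⟩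
  exact (LinearMap.congr_fun hg ⟨h, hh, hL⟩).symm

lemma exN (ε : ℝ) (hε0 : 0 < ε) (hε1 : ε < 1) (F : Finset (ℕ × ℕ)) (k : ℤ) :
    ∃ N : ℕ, ∀ p q : ℕ, (p : ℤ) - q = k → N ≤ p → (q, p) ∉ F ∧ memKappa ε q p := by
  obtain ⟨M, hM⟩ := exists_nat_gt ((|k| : ℤ) / ε : ℝ)
  refine ⟨M + k.natAbs + 1 + F.sup Prod.snd, fun p q hpq hN => ⟨fun hF => ?_, ?_⟩⟩
  · have := Finset.le_sup (f := Prod.snd) hF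
    simp at this
    omega
  · have hMq : M + 1 ≤ q := by omega
    have hMp : M + 1 ≤ p := by omega
    have hqr : ((M : ℝ) + 1) ≤ q := by exact_mod_cast hMq
    have hpr : ((M : ℝ) + 1) ≤ p := by exact_mod_cast hMp
    rw [div_lt_iff₀ hε0] at hM
    have hk : (p : ℝ) - q = (k : ℝ) := by exact_mod_cast hpq
    have ha : |(k : ℝ)| < M * ε := by simpa using hM
    obtain ⟨ha1, ha2⟩ := abs_lt.1 ha
    have hM0 : (0 : ℝ) ≤ M := by positivity
    have hq0 : (0 : ℝ) < q := by linarith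
    refine ⟨by omega, by omega, ?_, ?_⟩
    · rw [lt_div_iff₀ hq0]; nlinarith
    · rw [div_lt_div_iff₀ hq0 (by linarith)]; nlinarith

lemma ev_finsum {n : ℕ} {ι : Type*} (s : Finset ι) (g : ι → Pol n) (z : Ez n) :
    ev (∑ i ∈ s, g i) z = ∑ i ∈ s, ev (g i) z := by simp [ev]

lemma rep1 {n : ℕ} {ν : Measure (Ez n)} (hν : ∀ᵐ x ∂ν, x ∈ unitSphere n)
    {f : Ez n → ℂ} (hf : Integrable f ν)
    (ε : ℝ) (hε0 : 0 < ε) (hε1 : ε < 1) (F : Finset (ℕ × ℕ))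
    (hspec : ∀ p q : ℕ, (p, q) ∉ F → memKappa ε p q → projPQZero ν f p q) (k : ℤ) :
    ∃ g : Pol n, ∀ p q : ℕ, (p : ℤ) - q = k → ∀ h : Pol n, BH h p q → Lap h = 0 →
      ∫ z, ev h z * f z ∂ν = ∫ z, ev h z * ev g z ∂(sg n) := by
  obtain ⟨N, hN⟩ := exN ε hε0 hε1 F k
  choose G hG1 hG2 hG3 using fun p q => riesz (n := n) p q hν hf
  refine ⟨∑ p' ∈ Finset.range N, if k ≤ p' then G p' ((p' : ℤ) - k).toNat else 0, ?_⟩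
  intro p q hpq h hh hL
  have hsum : ∫ z, ev h z * ev (∑ p' ∈ Finset.range N, if k ≤ p' then G p' ((p' : ℤ) - k).toNat else 0) z ∂(sg n)
      = ∑ p' ∈ Finset.range N, ∫ z, ev h z * ev (if k ≤ p' then G p' ((p' : ℤ) - k).toNat else 0) z ∂(sg n) := by
    rw [← integral_finsetSum]
    · congr 1; ext z; rw [ev_finsum, Finset.mul_sum]
    · intro i _; exact sg_cont ((continuous_ev _).mul (continuous_ev _))
  rw [hsum]
  have hz : ∀ p' : ℕ, p' ≠ p → ∫ z, ev h z * ev (if k ≤ p' then G p' ((p' : ℤ) - k).toNat else 0) z ∂(sg n) = 0 := by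
    intro p' hne
    split_ifs with hk
    · exact orth hh (hG1 _ _) hL (hG2 _ _) (by omega)
    · simp
  by_cases hp : p < N
  · rw [Finset.sum_eq_single p (fun b _ hb => hz b hb) (fun h => absurd (Finset.mem_range.2 hp) h)]
    rw [if_pos (by omega)]
    have : ((p : ℤ) - k).toNat = q := by omega
    rw [this]
    exact hG3 p q h hh hL
  · rw [Finset.sum_eq_zero (fun b hb => hz b (by have := Finset.mem_range.1 hb; omega))]
    obtain ⟨h1, h2⟩ := hN p q hpq (by omega)
    have := hspec q p h1 h2 (ev (cj h)) (memHpq_ev (cj_BH hh) (cj_Lap hL))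
    simpa [ev_cj] using this

lemma rep2 {n : ℕ} (hn : 0 < n) {ν : Measure (Ez n)} (hν : ∀ᵐ x ∂ν, x ∈ unitSphere n)
    {f : Ez n → ℂ} (hf : Integrable f ν)
    (ε : ℝ) (hε0 : 0 < ε) (hε1 : ε < 1) (F : Finset (ℕ × ℕ))
    (hspec : ∀ p q : ℕ, (p, q) ∉ F → memKappa ε p q → projPQZero ν f p q) (k : ℤ) :
    ∃ g : Pol n, ∀ p q : ℕ, (p : ℤ) - q = k → ∀ h : Pol n, BH h p q →
      ∫ z, ev h z * f z ∂ν = ∫ z, ev h z * ev g z ∂(sg n) := by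
  obtain ⟨g, hg⟩ := rep1 hν hf ε hε0 hε1 F hspec k
  refine ⟨g, ?_⟩
  intro p
  induction p with
  | zero => intro q hk h hh; exact hg 0 q hk h hh (Lap_zero_left hh)
  | succ p ih =>
    intro q hk h hh
    cases q with
    | zero => exact hg _ _ hk h hh (Lap_zero_right hh)
    | succ q =>
      obtain ⟨Q, hQ, hQL, hQ2⟩ := fischer hn hh
      have h1 := hg _ _ hk _ hQ2 hQL
      have h2 := ih q (by push_cast at hk; omega) Q hQ
      have e : ∀ z ∈ unitSphere n, ev h z = ev (h - rr n * Q) z + ev Q z := by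
        intro z hz
        have hz1 : ‖z‖ = 1 := by simpa [unitSphere] using hz
        rw [ev_sub, ev_mul, ev_rr, hz1]; simp
      have key : ∀ (μ : Measure (Ez n)) (u : Ez n → ℂ), (∀ᵐ x ∂μ, x ∈ unitSphere n) → Integrable u μ →
          ∫ z, ev h z * u z ∂μ = ∫ z, ev (h - rr n * Q) z * u z ∂μ + ∫ z, ev Q z * u z ∂μ := by
        intro μ u hμ hu
        rw [← integral_add (integrable_cont_mul hμ (continuous_ev _) hu) (integrable_cont_mul hμ (continuous_ev _) hu)]
        refine integral_congr_ae ?_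
        filter_upwards [hμ] with z hz
        rw [e z hz]; ring
      rw [key ν f hν hf, key (sg n) (ev g) sg_ae (sg_cont (continuous_ev g)), h1, h2]


lemma sw {X ι : Type*} [MetricSpace X] {K : Set X} (hK : IsCompact K)
    (c : ι → X → ℂ) (hc : ∀ i, Continuous (c i)) (s : ι → ι)
    (hs : ∀ i, ∀ x ∈ K, starRingEnd ℂ (c i x) = c (s i) x)
    (hsep : ∀ x ∈ K, ∀ y ∈ K, (∀ i, c i x = c i y) → x = y)
    {v : X → ℂ} (hv : Continuous v) {δ : ℝ} (hδ : 0 < δ) :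
    ∃ R : MvPolynomial ι ℂ, ∀ x ∈ K, ‖v x - eval (fun i => c i x) R‖ ≤ δ := by
  have : CompactSpace K := isCompact_iff_compactSpace.1 hK
  let cc : ι → C(K, ℂ) := fun i => ⟨fun x => c i x, (hc i).comp continuous_subtype_val⟩
  obtain ⟨A, hAm⟩ : ∃ A : StarSubalgebra ℂ C(K, ℂ), ∀ a, a ∈ A ↔ ∃ R, aeval (R := ℂ) cc R = a := by
    refine ⟨{ (aeval (R := ℂ) cc).range with
      star_mem' := ?_ }, fun a => Iff.rfl⟩
    rintro a ⟨R, rfl⟩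
    change star (aeval cc R) ∈ (aeval (R := ℂ) cc).range
    induction R using MvPolynomial.induction_on with
    | C a =>
      rw [aeval_C, ← algebraMap_star_comm]
      exact Subalgebra.algebraMap_mem _ _
    | add p q hp hq =>
      rw [map_add, star_add]
      exact add_mem hp hq
    | mul_X p i hp =>
      rw [map_mul, star_mul', aeval_X]
      refine mul_mem hp ⟨MvPolynomial.X (s i), ?_⟩
      change aeval cc (MvPolynomial.X (s i)) = _
      rw [aeval_X]
      ext x
      exact (hs i x.1 x.2).symm
  have hA : A.SeparatesPoints := by
    intro x y hxy
    by_contra hcon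
    apply hxy
    apply Subtype.ext
    refine hsep x.1 x.2 y.1 y.2 fun i => ?_
    by_contra hne
    have hm : cc i ∈ A := (hAm _).2 ⟨MvPolynomial.X i, aeval_X cc i⟩
    exact hcon ⟨cc i, ⟨cc i, hm, rfl⟩, hne⟩
  have htop := ContinuousMap.starSubalgebra_topologicalClosure_eq_top_of_separatesPoints A hA
  let vv : C(K, ℂ) := ⟨fun x => v x, hv.comp continuous_subtype_val⟩
  have hmem : vv ∈ A.topologicalClosure := by rw [htop]; trivial
  have hmem' : vv ∈ closure (A : Set C(K, ℂ)) := hmem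
  obtain ⟨b, hbA, hb⟩ := Metric.mem_closure_iff.1 hmem' δ hδ
  obtain ⟨R, hR⟩ := (hAm b).1 hbA
  refine ⟨R, fun x hx => ?_⟩
  have h1 : (b : C(K, ℂ)) ⟨x, hx⟩ = eval (fun i => c i x) R := by
    rw [← hR]
    change (aeval cc R) ⟨x, hx⟩ = _
    clear hR
    induction R using MvPolynomial.induction_on with
    | C a => simp
    | add p q hp hq => simp [hp, hq]
    | mul_X p i hp => simp [hp]; left; rfl
  rw [← h1]
  have h2 := ContinuousMap.dist_apply_le_dist (f := vv) (g := b) ⟨x, hx⟩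
  rw [dist_eq_norm] at h2
  exact h2.trans hb.le

section
variable {X Ω : Type*} [MetricSpace X] [MeasurableSpace X] [BorelSpace X]
  [MeasurableSpace Ω]

lemma int_bdd {μ : Measure Ω} {T : Ω → X} (hT : Measurable T) {K : Set X} (hK : IsCompact K)
    (hTK : ∀ᵐ w ∂μ, T w ∈ K) {F : Ω → ℂ} (hF : Integrable F μ) {v : X → ℂ} (hv : Continuous v) :
    Integrable (fun w => v (T w) * F w) μ := by
  obtain ⟨C, hC⟩ := hK.exists_bound_of_continuousOn hv.continuousOn
  refine hF.bdd_mul (hv.measurable.comp hT).aestronglyMeasurable (c := C) ?_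
  filter_upwards [hTK] with x hx
  exact hC _ hx

lemma int_diff {μ : Measure Ω} {T : Ω → X} (hT : Measurable T) {K : Set X} (hK : IsCompact K)
    (hTK : ∀ᵐ w ∂μ, T w ∈ K) {F : Ω → ℂ} (hF : Integrable F μ) {v u : X → ℂ} (hv : Continuous v)
    (hu : Continuous u) {δ : ℝ} (h : ∀ x ∈ K, ‖v x - u x‖ ≤ δ) :
    ‖∫ w, v (T w) * F w ∂μ - ∫ w, u (T w) * F w ∂μ‖ ≤ δ * ∫ w, ‖F w‖ ∂μ := by
  rw [← integral_sub (int_bdd hT hK hTK hF hv) (int_bdd hT hK hTK hF hu), ← integral_const_mul]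
  refine norm_integral_le_of_norm_le (hF.norm.const_mul δ) ?_
  filter_upwards [hTK] with w hw
  rw [← sub_mul, norm_mul]
  exact mul_le_mul_of_nonneg_right (h _ hw) (norm_nonneg _)

lemma tend_closed {μ : Measure Ω} {T : Ω → X} (hT : Measurable T) {F : Ω → ℂ} (hF : Integrable F μ)
    {B : Set X} (hB : IsClosed B) :
    Filter.Tendsto (fun m : ℕ => ∫ w, ((thickenedIndicator (Nat.one_div_pos_of_nat (α := ℝ) (n := m)) B (T w) : ℝ≥0) : ℂ) * F w ∂μ)
      Filter.atTop (nhds (∫ w in T ⁻¹' B, F w ∂μ)) := by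
  rw [← integral_indicator (hT hB.measurableSet)]
  refine tendsto_integral_of_dominated_convergence (fun w => ‖F w‖) ?_ hF.norm ?_ ?_
  · intro m
    refine AEStronglyMeasurable.mul ?_ hF.1
    have h1 : Continuous fun x : X => ((thickenedIndicator (Nat.one_div_pos_of_nat (α := ℝ) (n := m)) B x : ℝ≥0) : ℂ) :=
      Complex.continuous_ofReal.comp (NNReal.continuous_coe.comp (thickenedIndicator _ B).continuous)
    exact (h1.measurable.comp hT).aestronglyMeasurable
  · intro m
    refine Filter.Eventually.of_forall fun w => ?_
    rw [norm_mul]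
    have h1 := thickenedIndicator_le_one (Nat.one_div_pos_of_nat (α := ℝ) (n := m)) B (T w)
    have h2 : ‖((thickenedIndicator (Nat.one_div_pos_of_nat (α := ℝ) (n := m)) B (T w) : ℝ≥0) : ℂ)‖ ≤ 1 := by
      have : ‖((thickenedIndicator (Nat.one_div_pos_of_nat (α := ℝ) (n := m)) B (T w) : ℝ≥0) : ℂ)‖
        = ((thickenedIndicator (Nat.one_div_pos_of_nat (α := ℝ) (n := m)) B (T w) : ℝ≥0) : ℝ) := by
        rw [Complex.norm_real]; simp
      rw [this]; exact_mod_cast h1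
    exact mul_le_of_le_one_left (norm_nonneg _) h2
  · refine Filter.Eventually.of_forall fun w => ?_
    have h1 := thickenedIndicator_tendsto_indicator_closure (δseq := fun m : ℕ => 1 / ((m : ℝ) + 1))
      (fun m => Nat.one_div_pos_of_nat) tendsto_one_div_add_atTop_nhds_zero_nat B
    rw [tendsto_pi_nhds] at h1
    have h2 := h1 (T w)
    rw [hB.closure_eq] at h2
    have h3 := (Complex.continuous_ofReal.comp NNReal.continuous_coe).continuousAt.tendsto.comp h2
    have h4 := h3.mul_const (F w)
    refine h4.congr' (Filter.Eventually.of_forall fun m => rfl) |>.trans_eq ?_ 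
    congr 1
    by_cases hw : T w ∈ B
    · have : w ∈ T ⁻¹' B := hw
      simp [hw, Set.indicator]
    · have : w ∉ T ⁻¹' B := hw
      simp [hw, Set.indicator]

end

lemma push_eq {X Ω₁ Ω₂ ι : Type*} [MetricSpace X] [MeasurableSpace X] [BorelSpace X]
    [MeasurableSpace Ω₁] [MeasurableSpace Ω₂] {K : Set X} (hK : IsCompact K)
    (c : ι → X → ℂ) (hc : ∀ i, Continuous (c i)) (s : ι → ι)
    (hs : ∀ i, ∀ x ∈ K, starRingEnd ℂ (c i x) = c (s i) x)
    (hsep : ∀ x ∈ K, ∀ y ∈ K, (∀ i, c i x = c i y) → x = y)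
    {μ₁ : Measure Ω₁} {μ₂ : Measure Ω₂} {T₁ : Ω₁ → X} {T₂ : Ω₂ → X}
    (hT₁ : Measurable T₁) (hT₂ : Measurable T₂) (hK₁ : ∀ᵐ w ∂μ₁, T₁ w ∈ K) (hK₂ : ∀ᵐ w ∂μ₂, T₂ w ∈ K)
    {F₁ : Ω₁ → ℂ} {F₂ : Ω₂ → ℂ} (hF₁ : Integrable F₁ μ₁) (hF₂ : Integrable F₂ μ₂)
    (h : ∀ R : MvPolynomial ι ℂ, ∫ w, eval (fun i => c i (T₁ w)) R * F₁ w ∂μ₁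
      = ∫ w, eval (fun i => c i (T₂ w)) R * F₂ w ∂μ₂)
    {B : Set X} (hB : MeasurableSet B) :
    ∫ w in T₁ ⁻¹' B, F₁ w ∂μ₁ = ∫ w in T₂ ⁻¹' B, F₂ w ∂μ₂ := by
  have hcont : ∀ v : X → ℂ, Continuous v → ∫ w, v (T₁ w) * F₁ w ∂μ₁ = ∫ w, v (T₂ w) * F₂ w ∂μ₂ := by
    intro v hv
    by_contra hne
    set D := ‖∫ w, v (T₁ w) * F₁ w ∂μ₁ - ∫ w, v (T₂ w) * F₂ w ∂μ₂‖ with hD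
    have hDpos : 0 < D := norm_pos_iff.2 (sub_ne_zero.2 hne)
    set M := ∫ w, ‖F₁ w‖ ∂μ₁ + ∫ w, ‖F₂ w‖ ∂μ₂ with hM
    have hM0 : 0 ≤ M := by positivity
    obtain ⟨R, hR⟩ := sw hK c hc s hs hsep hv (δ := D / (2 * (M + 1))) (by positivity)
    have hRc : Continuous fun x => eval (fun i => c i x) R :=
      (MvPolynomial.continuous_eval R).comp (continuous_pi hc)
    have e1 := int_diff hT₁ hK hK₁ hF₁ hv hRc hR
    have e2 := int_diff hT₂ hK hK₂ hF₂ hv hRc hR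
    have e3 : D ≤ D / (2 * (M + 1)) * M := by
      rw [hM, mul_add]
      refine le_trans ?_ (add_le_add e1 e2)
      rw [hD, h R]
      refine le_trans (le_of_eq ?_) (norm_sub_le _ _)
      congr 1; ring
    rw [div_mul_eq_mul_div, le_div_iff₀ (by positivity)] at e3
    nlinarith
  have hclosed : ∀ B : Set X, IsClosed B → ∫ w in T₁ ⁻¹' B, F₁ w ∂μ₁ = ∫ w in T₂ ⁻¹' B, F₂ w ∂μ₂ := by
    intro B hB
    refine tendsto_nhds_unique (tend_closed hT₁ hF₁ hB) ((tend_closed hT₂ hF₂ hB).congr fun m => ?_)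
    exact (hcont (fun x : X => ((thickenedIndicator (Nat.one_div_pos_of_nat (α := ℝ) (n := m)) B x : ℝ≥0) : ℂ))
      (Complex.continuous_ofReal.comp (NNReal.continuous_coe.comp (thickenedIndicator _ B).continuous))).symm
  have hgen : (inferInstance : MeasurableSpace X) = MeasurableSpace.generateFrom {s | IsClosed s} := by
    rw [← borel_eq_generateFrom_isClosed]; exact BorelSpace.measurable_eq
  induction B, hB using MeasurableSpace.induction_on_inter hgen isPiSystem_isClosed with
  | empty => simp
  | basic t ht => exact hclosed t ht
  | compl t ht ih =>
    have hu := hclosed univ isClosed_univ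
    simp only [preimage_univ, Measure.restrict_univ] at hu
    rw [preimage_compl, preimage_compl, setIntegral_compl (hT₁ ht) hF₁, setIntegral_compl (hT₂ ht) hF₂, ih, hu]
  | iUnion g hd hm ih =>
    rw [preimage_iUnion, preimage_iUnion,
      integral_iUnion (fun i => hT₁ (hm i)) (fun i j hij => (hd hij).preimage _) hF₁.integrableOn,
      integral_iUnion (fun i => hT₂ (hm i)) (fun i j hij => (hd hij).preimage _) hF₂.integrableOn]
    simp_rw [ih]


abbrev Yz (n : ℕ) := Fin n × Fin n → ℂ

def Phi {n : ℕ} (z : Ez n) : Yz n := fun ij => z ij.1 * starRingEnd ℂ (z ij.2)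

lemma continuous_Phi {n : ℕ} : Continuous (Phi (n := n)) := by
  unfold Phi
  refine continuous_pi fun ij => ?_
  exact (by fun_prop : Continuous fun z : Ez n => z ij.1).mul
    (Complex.continuous_conj.comp (by fun_prop : Continuous fun z : Ez n => z ij.2))

lemma coord_le {n : ℕ} (z : Ez n) (i : Fin n) : ‖z i‖ ≤ ‖z‖ := PiLp.norm_apply_le z i

lemma norm_le_sum {n : ℕ} (z : Ez n) : ‖z‖ ≤ ∑ i, ‖z i‖ := by
  rw [EuclideanSpace.norm_eq]
  refine Real.sqrt_le_iff.2 ⟨by positivity, ?_⟩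
  exact Finset.sum_sq_le_sq_sum_of_nonneg (fun i _ => norm_nonneg _)

lemma Phi_lip {n : ℕ} : LipschitzOnWith 2 (Phi (n := n)) (unitSphere n) := by
  refine LipschitzOnWith.of_dist_le_mul fun z hz w hw => ?_
  have hz1 : ‖z‖ = 1 := by simpa [unitSphere] using hz
  have hw1 : ‖w‖ = 1 := by simpa [unitSphere] using hw
  rw [dist_pi_le_iff (by positivity)]
  rintro ⟨i, j⟩
  rw [dist_eq_norm, dist_eq_norm]
  have e : Phi z (i, j) - Phi w (i, j) = z i * starRingEnd ℂ ((z - w) j) + (z - w) i * starRingEnd ℂ (w j) := by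
    simp [Phi]; ring
  rw [e]
  refine (norm_add_le _ _).trans ?_
  rw [norm_mul, norm_mul, RCLike.norm_conj, RCLike.norm_conj]
  have h1 := coord_le z i
  have h2 := coord_le (z - w) j
  have h3 := coord_le (z - w) i
  have h4 := coord_le w j
  rw [hz1] at h1
  rw [hw1] at h4
  have := mul_le_mul h1 h2 (norm_nonneg _) zero_le_one
  have := mul_le_mul h3 h4 (norm_nonneg _) (norm_nonneg _)
  push_cast
  linarith

lemma near {n : ℕ} {z w : Ez n} (hz : ‖z‖ = 1) (hw : ‖w‖ = 1) {d : ℝ} (hd : dist (Phi z) (Phi w) ≤ d) :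
    ∃ a : ℂ, ‖a‖ ≤ 1 ∧ ‖z - a • w‖ ≤ n ^ 2 * d := by
  have hd0 : 0 ≤ d := dist_nonneg.trans hd
  refine ⟨inner ℂ w z, ?_, ?_⟩
  · have := norm_inner_le_norm (𝕜 := ℂ) w z
    rwa [hz, hw, one_mul] at this
  · refine (norm_le_sum _).trans ?_
    have : ∀ i : Fin n, ‖(z - (inner ℂ w z : ℂ) • w) i‖ ≤ n * d := by
      intro i
      have hs : ∑ j, z j * starRingEnd ℂ (z j) = 1 := by
        have h1 := ev_rr z
        rw [hz] at h1
        simpa [rr] using h1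
      have e : (z - (inner ℂ w z : ℂ) • w) i = ∑ j, (Phi z (i, j) - Phi w (i, j)) * z j := by
        have : ∑ j, (Phi z (i, j) - Phi w (i, j)) * z j
            = z i * ∑ j, z j * starRingEnd ℂ (z j) - (∑ j, z j * starRingEnd ℂ (w j)) * w i := by
          rw [Finset.mul_sum, Finset.sum_mul, ← Finset.sum_sub_distrib]
          refine Finset.sum_congr rfl fun j _ => ?_
          simp [Phi]; ring
        rw [this, hs]
        simp [PiLp.inner_apply]
      rw [e]
      refine (norm_sum_le _ _).trans ?_
      have : ∀ j ∈ (Finset.univ : Finset (Fin n)), ‖(Phi z (i, j) - Phi w (i, j)) * z j‖ ≤ d := by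
        intro j _
        rw [norm_mul]
        have h1 : ‖Phi z (i, j) - Phi w (i, j)‖ ≤ d := by
          rw [← dist_eq_norm]; exact (dist_le_pi_dist _ _ _).trans hd
        have h2 := coord_le z j
        rw [hz] at h2
        have := mul_le_mul h1 h2 (norm_nonneg _) hd0
        linarith
      refine (Finset.sum_le_sum this).trans ?_
      simp
    refine (Finset.sum_le_sum fun i _ => this i).trans ?_
    simp
    apply le_of_eq; ring

lemma finrank_Ez (n : ℕ) : Module.finrank ℝ (Ez n) = 2 * n := by
  rw [← Module.finrank_mul_finrank ℝ ℂ (Ez n)]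
  simp

def tube {n : ℕ} (w : Ez n) (R : ℝ) : Set (Ez n) := {x | ∃ l : ℂ, ‖l‖ ≤ 2 ∧ ‖x - l • w‖ ≤ R}

lemma tube_le {n : ℕ} (hn : 1 ≤ n) {w : Ez n} (hw : ‖w‖ = 1) {R : ℝ} (hR : 0 < R) (hR1 : R ≤ 1) :
    m0 n (tube w R) ≤ ENNReal.ofReal (49 * 9 ^ n * R ^ (2 * n - 2)) * m0 n (ball 0 1) := by
  set M : ℕ := ⌈2 / R⌉₊ with hM
  set I : Finset ℤ := Finset.Icc (-(M : ℤ)) M with hI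
  have hM1 : 2 / R ≤ M := Nat.le_ceil _
  have hM2 : (M : ℝ) < 2 / R + 1 := Nat.ceil_lt_add_one (by positivity)
  have hcard : ((I ×ˢ I).card : ℝ) ≤ 49 / R ^ 2 := by
    have hc : I.card = 2 * M + 1 := by rw [hI, Int.card_Icc]; omega
    rw [Finset.card_product, hc]
    have h1 : (2 * (M : ℝ) + 1) ≤ 7 / R := by
      have : 1 ≤ 1 / R := by rw [le_div_iff₀ hR]; linarith
      have e : 7 / R = 2 * (2 / R) + 3 * (1 / R) := by field_simp; norm_num
      rw [e]; linarith
    push_cast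
    have e : 49 / R ^ 2 = (7 / R) * (7 / R) := by field_simp; norm_num
    rw [e]
    exact mul_le_mul h1 h1 (by positivity) (by positivity)
  let ctr : ℤ × ℤ → Ez n := fun ab => ((R * ab.1 : ℝ) + (R * ab.2 : ℝ) * Complex.I : ℂ) • w
  have hfl : ∀ t : ℝ, |t| ≤ 2 → ⌊t / R⌋ ∈ I ∧ |t - R * ⌊t / R⌋| ≤ R := by
    intro t ht
    obtain ⟨ht1, ht2⟩ := abs_le.1 ht
    have f1 := Int.floor_le (t / R)
    have f2 := Int.lt_floor_add_one (t / R)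
    rw [le_div_iff₀ hR] at f1
    rw [div_lt_iff₀ hR] at f2
    rw [div_le_iff₀ hR] at hM1
    refine ⟨?_, ?_⟩
    · rw [hI, Finset.mem_Icc]
      constructor
      · rw [Int.le_floor, le_div_iff₀ hR]; push_cast; linarith
      · have : (⌊t / R⌋ : ℝ) ≤ M := by
          by_contra hcon
          push Not at hcon
          nlinarith
        exact_mod_cast this
    · rw [abs_le]; constructor <;> nlinarith
  have hcov : tube w R ⊆ ⋃ ab ∈ I ×ˢ I, closedBall (ctr ab) (3 * R) := by
    rintro x ⟨l, hl, hx⟩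
    obtain ⟨h1, h2⟩ := hfl l.re ((Complex.abs_re_le_norm l).trans hl)
    obtain ⟨h3, h4⟩ := hfl l.im ((Complex.abs_im_le_norm l).trans hl)
    refine mem_iUnion₂.2 ⟨(⌊l.re / R⌋, ⌊l.im / R⌋), Finset.mem_product.2 ⟨h1, h3⟩, ?_⟩
    rw [mem_closedBall, dist_eq_norm]
    have e : x - ctr (⌊l.re / R⌋, ⌊l.im / R⌋) = (x - l • w) +
        (l - ((R * ⌊l.re / R⌋ : ℝ) + (R * ⌊l.im / R⌋ : ℝ) * Complex.I : ℂ)) • w := by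
      simp only [ctr, sub_smul]; abel
    rw [e]
    refine (norm_add_le _ _).trans ?_
    rw [norm_smul, hw, mul_one]
    have h5 := Complex.norm_le_abs_re_add_abs_im (l - ((R * ⌊l.re / R⌋ : ℝ) + (R * ⌊l.im / R⌋ : ℝ) * Complex.I : ℂ))
    have h6 : (l - ((R * ⌊l.re / R⌋ : ℝ) + (R * ⌊l.im / R⌋ : ℝ) * Complex.I : ℂ)).re = l.re - R * ⌊l.re / R⌋ := by
      simp [Complex.sub_re, Complex.add_re, Complex.ofReal_re, -Complex.ofReal_mul]
    have h7 : (l - ((R * ⌊l.re / R⌋ : ℝ) + (R * ⌊l.im / R⌋ : ℝ) * Complex.I : ℂ)).im = l.im - R * ⌊l.im / R⌋ := by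
      simp [Complex.sub_im, Complex.add_im, Complex.ofReal_im, -Complex.ofReal_mul]
    rw [h6, h7] at h5
    linarith
  refine (measure_mono hcov).trans ((measure_biUnion_finset_le _ _).trans ?_)
  have : ∀ ab ∈ I ×ˢ I, m0 n (closedBall (ctr ab) (3 * R)) = ENNReal.ofReal ((3 * R) ^ (2 * n)) * m0 n (ball 0 1) := by
    intro ab _
    rw [Measure.addHaar_closedBall _ _ (by positivity), finrank_Ez]
  rw [Finset.sum_congr rfl this, Finset.sum_const, nsmul_eq_mul, ← mul_assoc]
  gcongr
  rw [← ENNReal.ofReal_natCast, ← ENNReal.ofReal_mul (by positivity)]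
  refine ENNReal.ofReal_le_ofReal ?_
  refine (mul_le_mul_of_nonneg_right hcard (by positivity)).trans (le_of_eq ?_)
  obtain ⟨m, rfl⟩ : ∃ m, n = m + 1 := ⟨n - 1, by omega⟩
  have e : 2 * (m + 1) - 2 = 2 * m := by omega
  rw [e, mul_pow, pow_mul 3]
  field_simp
  norm_num
  ring

lemma sg0_le {n : ℕ} {A : Set (Ez n)} (hA : MeasurableSet A) : sg0 n A ≤ 3 * m0 n A := by
  unfold sg0
  rw [withDensity_apply _ hA]
  calc ∫⁻ a in A, ENNReal.ofReal (dens a) ∂m0 n ≤ ∫⁻ a in A, 3 ∂m0 n := by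
        refine lintegral_mono fun a => ?_
        have := thw_le (‖a‖ ^ 2)
        refine (ENNReal.ofReal_le_ofReal this).trans (le_of_eq ?_)
        norm_num
    _ = 3 * m0 n A := by rw [setLIntegral_const]

lemma tube_meas {n : ℕ} (w : Ez n) (R : ℝ) : MeasurableSet (tube w R) := by
  have : tube w R = (fun p : ℂ × Ez n => p.1 • w + p.2) '' (closedBall 0 2 ×ˢ closedBall 0 R) := by
    ext x
    constructor
    · rintro ⟨l, hl, hx⟩
      exact ⟨(l, x - l • w), ⟨by simpa using hl, by simpa using hx⟩, by simp⟩
    · rintro ⟨⟨l, y⟩, ⟨hl, hy⟩, rfl⟩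
      exact ⟨l, by simpa using hl, by simpa using hy⟩
  rw [this]
  exact (((isCompact_closedBall _ _).prod (isCompact_closedBall _ _)).image (by fun_prop)).isClosed.measurableSet

def tau (n : ℕ) : Measure (Yz n) := Measure.map Phi (sg n)
instance (n : ℕ) : IsFiniteMeasure (tau n) := by unfold tau; infer_instance

lemma tau_le {n : ℕ} (hn : 1 ≤ n) {s : Set (Yz n)} (hs : IsClosed s) {d : ℝ} 
    (hsd : ∀ x ∈ s, ∀ y ∈ s, dist x y ≤ d) {R : ℝ} (hR : 0 < R) (hR1 : R ≤ 1) (hRd : 2 * n ^ 2 * d ≤ R) :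
    tau n s ≤ 3 * (ENNReal.ofReal (49 * 9 ^ n * R ^ (2 * n - 2)) * m0 n (ball 0 1)) := by
  unfold tau sg
  rw [Measure.map_apply continuous_Phi.measurable hs.measurableSet,
    Measure.map_apply measurable_rho (continuous_Phi.measurable hs.measurableSet)]
  by_cases hne : ∃ w : Ez n, ‖w‖ = 1 ∧ Phi w ∈ s
  · obtain ⟨w, hw, hws⟩ := hne
    have h1 : sg0 n (rho ⁻¹' (Phi ⁻¹' s)) ≤ sg0 n (tube w R) := by
      refine measure_mono_ae ?_
      filter_upwards [sg0_ae] with x hx hxs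
      obtain ⟨a, ha, hza⟩ := near (norm_rho hx.1) hw (hsd _ hxs _ hws)
      have hx0 : ‖x‖ ≠ 0 := by linarith [hx.1]
      have hx0c : (‖x‖ : ℂ) ≠ 0 := by exact_mod_cast hx0
      refine ⟨(‖x‖ : ℂ) * a, ?_, ?_⟩
      · rw [norm_mul, Complex.norm_real, norm_norm]
        nlinarith [norm_nonneg a, norm_nonneg x, hx.2]
      · have e : x - ((‖x‖ : ℂ) * a) • w = (‖x‖ : ℂ) • (rho x - a • w) := by
          rw [smul_sub, mul_smul]
          congr 1
          unfold rho
          ext i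
          simp
          field_simp
        rw [e, norm_smul, Complex.norm_real, norm_norm]
        have := norm_nonneg (rho x - a • w)
        nlinarith [hx.2, norm_nonneg x]
    exact h1.trans ((sg0_le (tube_meas w R)).trans (by gcongr; exact tube_le hn hw hR hR1))
  · have : sg0 n (rho ⁻¹' (Phi ⁻¹' s)) = 0 := by
      refine measure_mono_null (fun x hx => ?_) (ae_iff.1 (sg0_ae (n := n)))
      intro hcon
      exact hne ⟨rho x, norm_rho hcon.1, hx⟩
    rw [this]; exact zero_le

lemma tau_null {n : ℕ} (hn : 2 ≤ n) {E : Set (Ez n)} (hE : E ⊆ unitSphere n)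
    (hE0 : μH[2 * (n : ℝ) - 2] E = 0) : tau n (Phi '' E) = 0 := by
  have hd0 : (0 : ℝ) ≤ 2 * (n : ℝ) - 2 := by
    have : (2 : ℝ) ≤ n := by exact_mod_cast hn
    linarith
  have hn0 : (0 : ℝ) < n := by exact_mod_cast (by omega : 0 < n)
  have hcast : ((2 * n - 2 : ℕ) : ℝ) = 2 * (n : ℝ) - 2 := by
    rw [Nat.cast_sub (by omega)]; push_cast; ring
  have himg : μH[2 * (n : ℝ) - 2] (Phi '' E) = 0 := by
    have := (Phi_lip.mono hE).hausdorffMeasure_image_le hd0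
    rw [hE0, mul_zero] at this
    exact le_antisymm this zero_le
  have hmfin : m0 n (ball 0 1) ≠ ∞ := measure_ball_lt_top.ne
  set A : ℝ := 3 * (49 * 9 ^ n * (m0 n (ball 0 1)).toReal) with hA
  have hA0 : 0 ≤ A := by positivity
  have hb : ∀ (s : Set (Yz n)), IsClosed s → ∀ d : ℝ, 0 ≤ d → (∀ x ∈ s, ∀ y ∈ s, dist x y ≤ d) →
      2 * n ^ 2 * d < 1 → (tau n s).toReal ≤ A * (2 * n ^ 2 * d) ^ (2 * n - 2) := by
    intro s hs d hd hsd hd1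
    have hcont : Filter.Tendsto (fun R : ℝ => A * R ^ (2 * n - 2)) (nhdsWithin (2 * n ^ 2 * d) (Ioi (2 * n ^ 2 * d)))
        (nhds (A * (2 * n ^ 2 * d) ^ (2 * n - 2))) :=
      ((by fun_prop : Continuous fun R : ℝ => A * R ^ (2 * n - 2)).tendsto _).mono_left nhdsWithin_le_nhds
    refine ge_of_tendsto hcont ?_
    filter_upwards [Ioo_mem_nhdsGT hd1] with R hR
    have hR0 : 0 < R := lt_of_le_of_lt (by positivity) hR.1
    have h1 := tau_le (by omega) hs hsd hR0 hR.2.le hR.1.le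
    have h2 := ENNReal.toReal_mono (by finiteness) h1
    refine h2.trans (le_of_eq ?_)
    rw [ENNReal.toReal_mul, ENNReal.toReal_mul, ENNReal.toReal_ofReal (by positivity), hA]
    simp; ring
  set C : ℝ := A * (2 * n ^ 2) ^ (2 * n - 2) + 1 with hC
  have hC0 : 0 < C := by positivity
  have hle : (ENNReal.ofReal C)⁻¹ • tau n ≤ μH[2 * (n : ℝ) - 2] := by
    refine Measure.le_hausdorffMeasure _ _ (ENNReal.ofReal (1 / (4 * n ^ 2))) (by simp; positivity) fun s hs => ?_
    have hcl : ediam (closure s) = ediam s := ediam_closure s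
    set d : ℝ := (ediam s).toReal with hd
    have hsfin : ediam s ≠ ∞ := ne_top_of_le_ne_top ENNReal.ofReal_ne_top hs
    have hd1 : d ≤ 1 / (4 * n ^ 2) := ENNReal.toReal_le_of_le_ofReal (by positivity) hs
    have h1 := hb (closure s) isClosed_closure d ENNReal.toReal_nonneg (by
      intro x hx y hy
      have := edist_le_ediam_of_mem hx hy
      rw [hcl] at this
      rw [dist_edist]
      exact ENNReal.toReal_mono hsfin this) (by
      rw [le_div_iff₀ (by positivity)] at hd1
      nlinarith)
    have h2 : tau n s ≤ ENNReal.ofReal C * ediam s ^ (2 * (n : ℝ) - 2) := by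
      refine (measure_mono subset_closure).trans ?_
      rw [← ENNReal.ofReal_toReal (measure_ne_top (tau n) (closure s)), ← ENNReal.ofReal_toReal hsfin, ← hd, ← hcast,
        ENNReal.rpow_natCast, ← ENNReal.ofReal_pow ENNReal.toReal_nonneg, ← ENNReal.ofReal_mul hC0.le]
      refine ENNReal.ofReal_le_ofReal (h1.trans ?_)
      rw [mul_pow, ← mul_assoc]
      refine mul_le_mul_of_nonneg_right (by rw [hC]; linarith) (by positivity)
    rw [Measure.smul_apply, smul_eq_mul]
    rw [ENNReal.inv_mul_le_iff (by simpa using hC0) ENNReal.ofReal_ne_top]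
    exact h2
  have h3 := hle (Phi '' E)
  rw [himg, Measure.smul_apply, smul_eq_mul] at h3
  have h4 := le_antisymm h3 zero_le
  rcases mul_eq_zero.1 h4 with h5 | h5
  · simp at h5
  · exact h5


lemma BH_XX {n : ℕ} (i j : Fin n) : BH (X (Sum.inl i) * X (Sum.inr j) : Pol n) 1 1 := by
  have := (isWeightedHomogeneous_X ℂ (bw n) (Sum.inl i)).mul (isWeightedHomogeneous_X ℂ (bw n) (Sum.inr j))
  simpa [bw, BH] using this

lemma continuous_evalPhi {n : ℕ} (R : MvPolynomial (Fin n × Fin n) ℂ) :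
    Continuous fun z : Ez n => eval (Phi z) R := (MvPolynomial.continuous_eval R).comp continuous_Phi

lemma rep3 {n : ℕ} {ν : Measure (Ez n)} (hν : ∀ᵐ x ∂ν, x ∈ unitSphere n)
    {f : Ez n → ℂ} (hf : Integrable f ν) {k : ℤ} {g : Pol n}
    (hg : ∀ p q : ℕ, (p : ℤ) - q = k → ∀ h : Pol n, BH h p q →
      ∫ z, ev h z * f z ∂ν = ∫ z, ev h z * ev g z ∂(sg n)) (R : MvPolynomial (Fin n × Fin n) ℂ) :
    ∀ p q : ℕ, (p : ℤ) - q = k → ∀ h : Pol n, BH h p q →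
      ∫ z, eval (Phi z) R * (ev h z * f z) ∂ν = ∫ z, eval (Phi z) R * (ev h z * ev g z) ∂(sg n) := by
  induction R using MvPolynomial.induction_on with
  | C a =>
    intro p q hk h hh
    simp only [eval_C]
    rw [integral_const_mul, integral_const_mul, hg p q hk h hh]
  | add R S hR hS =>
    intro p q hk h hh
    simp only [map_add, add_mul]
    rw [integral_add, integral_add, hR p q hk h hh, hS p q hk h hh]
    · exact integrable_cont_mul sg_ae (continuous_evalPhi R) (integrable_cont_mul sg_ae (continuous_ev h) (sg_cont (continuous_ev g)))
    · exact integrable_cont_mul sg_ae (continuous_evalPhi S) (integrable_cont_mul sg_ae (continuous_ev h) (sg_cont (continuous_ev g)))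
    · exact integrable_cont_mul hν (continuous_evalPhi R) (integrable_cont_mul hν (continuous_ev h) hf)
    · exact integrable_cont_mul hν (continuous_evalPhi S) (integrable_cont_mul hν (continuous_ev h) hf)
  | mul_X R ij hR =>
    intro p q hk h hh
    have := hR (p + 1) (q + 1) (by push_cast; omega) _ (hh.mul (BH_XX ij.1 ij.2))
    have e : ∀ (z : Ez n) (u : ℂ), eval (Phi z) (R * X ij) * (ev h z * u)
        = eval (Phi z) R * (ev (h * (X (Sum.inl ij.1) * X (Sum.inr ij.2))) z * u) := by
      intro z u
      simp [Phi]; ring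
    simp only [e]
    exact this

lemma Phi_smul {n : ℕ} (t : ℝ) (z : Ez n) : Phi (Complex.exp (t * Complex.I) • z) = Phi z := by
  ext ij
  have h : Complex.exp (t * Complex.I) * starRingEnd ℂ (Complex.exp (t * Complex.I)) = 1 := by
    rw [Complex.mul_conj, Complex.normSq_eq_norm_sq, Complex.norm_exp_ofReal_mul_I]; simp
  simp only [Phi, PiLp.smul_apply, smul_eq_mul, map_mul]
  linear_combination (z ij.1 * starRingEnd ℂ (z ij.2)) * h

lemma zero_on {n : ℕ} (hn : 0 < n) {ν : Measure (Ez n)} (hν : ∀ᵐ x ∂ν, x ∈ unitSphere n)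
    {f : Ez n → ℂ} (hf : Integrable f ν)
    (ε : ℝ) (hε0 : 0 < ε) (hε1 : ε < 1) (F : Finset (ℕ × ℕ))
    (hspec : ∀ p q : ℕ, (p, q) ∉ F → memKappa ε p q → projPQZero ν f p q)
    {B : Set (Yz n)} (hB : MeasurableSet B) (hB0 : tau n B = 0) :
    ∀ᵐ x ∂ν, x ∈ Phi ⁻¹' B → f x = 0 := by
  have hPm : Measurable (Phi (n := n)) := continuous_Phi.measurable
  have hsg0 : sg n (Phi ⁻¹' B) = 0 := by
    rw [← Measure.map_apply hPm hB]; exact hB0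
  have hK : IsCompact (Phi '' unitSphere n) := (isCompact_sphere (0 : Ez n) 1).image continuous_Phi
  have hbh : ∀ p q : ℕ, ∀ h : Pol n, BH h p q → ∫ z in Phi ⁻¹' B, ev h z * f z ∂ν = 0 := by
    intro p q h hh
    obtain ⟨g, hg⟩ := rep2 hn hν hf ε hε0 hε1 F hspec ((p : ℤ) - q)
    have := push_eq (μ₁ := ν) (μ₂ := sg n) hK (fun (ij : Fin n × Fin n) (y : Yz n) => y ij)
      (fun ij => continuous_apply ij) Prod.swap
      (by
        rintro ⟨i, j⟩ _ ⟨z, _, rfl⟩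
        simp [Phi, mul_comm])
      (fun x _ y _ hxy => funext hxy) hPm hPm
      (by filter_upwards [hν] with z hz using ⟨z, hz, rfl⟩)
      (by filter_upwards [sg_ae] with z hz using ⟨z, hz, rfl⟩)
      (integrable_cont_mul hν (continuous_ev h) hf)
      (integrable_cont_mul sg_ae (continuous_ev h) (sg_cont (continuous_ev g)))
      (fun R => rep3 hν hf hg R p q rfl h hh) hB
    rw [this, setIntegral_measure_zero _ hsg0]
  have hind : Integrable ((Phi ⁻¹' B).indicator f) ν := hf.indicator (hPm hB)
  have hpol : ∀ R : Pol n, ∫ z, ev R z * (Phi ⁻¹' B).indicator f z ∂ν = 0 := by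
    intro R
    induction R using MvPolynomial.induction_on' with
    | monomial d a =>
      have hbm : BH (monomial d a : Pol n) (Finsupp.weight (bw n) d).1 (Finsupp.weight (bw n) d).2 :=
        isWeightedHomogeneous_monomial _ _ _ rfl
      rw [← hbh _ _ _ hbm, ← integral_indicator (hPm hB)]
      congr 1; ext z
      by_cases hz : z ∈ Phi ⁻¹' B
      · rw [indicator_of_mem hz, indicator_of_mem hz]
      · rw [indicator_of_notMem hz, indicator_of_notMem hz, mul_zero]
    | add P Q hP hQ =>
      simp only [ev_add, add_mul]
      rw [integral_add (integrable_cont_mul hν (continuous_ev _) hind) (integrable_cont_mul hν (continuous_ev _) hind), hP, hQ, add_zero]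
  have hz : (Phi ⁻¹' B).indicator f =ᵐ[ν] 0 := by
    refine Integrable.ae_eq_zero_of_forall_setIntegral_eq_zero hind fun s hs _ => ?_
    have := push_eq (μ₁ := ν) (μ₂ := ν) (isCompact_sphere (0 : Ez n) 1)
      (fun (i : Fin n ⊕ Fin n) (z : Ez n) => cv z i)
      (by
        rintro (i | i)
        · exact (by fun_prop : Continuous fun z : Ez n => z i)
        · exact Complex.continuous_conj.comp (by fun_prop : Continuous fun z : Ez n => z i)) Sum.swap
      (by
        rintro (i | i) z _
        · simp [cv]
        · simp [cv])
      (fun x _ y _ hxy => by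
        ext i
        exact hxy (Sum.inl i)) measurable_id measurable_id hν hν hind (integrable_zero _ ℂ _)
      (fun R => by
        have := hpol R
        simpa [ev] using this) hs
    simpa using this
  filter_upwards [hz] with x hx hxB
  rwa [indicator_of_mem hxB] at hx

theorem final_aux {n : ℕ} (hn : 2 ≤ n)
    (ν : Measure (EuclideanSpace ℂ (Fin n))) [IsFiniteMeasure ν]
    (hsupp : ν (unitSphere n)ᶜ = 0)
    (f : EuclideanSpace ℂ (Fin n) → ℂ) (hf : Integrable f ν)
    (ε : ℝ) (hε0 : 0 < ε) (hε1 : ε < 1) (F : Finset (ℕ × ℕ))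
    (hspec : ∀ p q : ℕ, (p, q) ∉ F → memKappa ε p q → projPQZero ν f p q)
    (E : Set (EuclideanSpace ℂ (Fin n))) (hEs : E ⊆ unitSphere n)
    (hE0 : μH[2 * (n : ℝ) - 2] E = 0) :
    ∫ x in circleOrbit E, ‖f x‖ ∂ν = 0 := by
  have hν : ∀ᵐ x ∂ν, x ∈ unitSphere n := hsupp
  have h0 := tau_null hn hEs hE0
  have h1 := zero_on (by omega) hν hf ε hε0 hε1 F hspec (measurableSet_toMeasurable (tau n) (Phi '' E))
    (by rw [measure_toMeasurable, h0])
  have hsub : circleOrbit E ⊆ Phi ⁻¹' (toMeasurable (tau n) (Phi '' E)) := by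
    rintro w ⟨z, hz, t, rfl⟩
    apply subset_toMeasurable
    rw [Phi_smul]
    exact ⟨z, hz, rfl⟩
  have hm : MeasurableSet (Phi ⁻¹' (toMeasurable (tau n) (Phi '' E))) :=
    continuous_Phi.measurable (measurableSet_toMeasurable _ _)
  have h2 : ∀ᵐ x ∂(ν.restrict (Phi ⁻¹' (toMeasurable (tau n) (Phi '' E)))), f x = 0 :=
    (ae_restrict_iff' hm).2 h1
  have h3 := ae_mono (Measure.restrict_mono hsub le_rfl) h2
  refine integral_eq_zero_of_ae ?_
  filter_upwards [h3] with x hx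
  simp [hx]

end Helpers

/-- a finite complex measure `μ = f·ν` on `S^{2n−1}` whose spectrum meets
`κ(ε)` in a finite set satisfies `|μ|(𝕋·E) = 0` whenever `H^{2n−2}(E) = 0`. -/
theorem stmt8 {n : ℕ} (hn : 2 ≤ n)
    (ν : Measure (EuclideanSpace ℂ (Fin n))) [IsFiniteMeasure ν]
    (hsupp : ν (unitSphere n)ᶜ = 0)
    (f : EuclideanSpace ℂ (Fin n) → ℂ) (hf : Integrable f ν)
    (ε : ℝ) (hε0 : 0 < ε) (hε1 : ε < 1) (F : Finset (ℕ × ℕ))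
    (hspec : ∀ p q : ℕ, (p, q) ∉ F → memKappa ε p q → projPQZero ν f p q)
    (E : Set (EuclideanSpace ℂ (Fin n))) (hEs : E ⊆ unitSphere n)
    (hE0 : μH[2 * (n : ℝ) - 2] E = 0) :
    ∫ x in circleOrbit E, ‖f x‖ ∂ν = 0 := by
  exact final_aux hn ν hsupp f hf ε hε0 hε1 F hspec E hEs hE0
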